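/- arXiv:1709.01982 — 3 statements merged into one kernel-verified Lean document; each statement's English description precedes it below -/
import Mathlib

section
/- For every weighted graph G = (V,E) with edge weights w : E → ℝ≥0 and every edge-stabilizer F ⊆ E of G, one has |F| ≥ ⌈γ(G)/2⌉. -/
namespace Stabilizer

variable {V : Type*} [Fintype V] [DecidableEq V]

/-- The set of vertices covered by a finite set of edges. -/
def edgeVerts (C : Finset (Sym2 V)) : Set V := {v | ∃ e ∈ C, v ∈ e}

/-- A matching of `G`, given as a finite set of pairwise vertex-disjoint edges. -/
def IsMatching (G : SimpleGraph V) (M : Finset (Sym2 V)) : Prop :=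
  (↑M ⊆ G.edgeSet) ∧ ∀ e ∈ M, ∀ f ∈ M, e ≠ f → ∀ v : V, v ∈ e → v ∉ f

/-- The total weight of a finite set of edges. -/
noncomputable def setWeight (w : Sym2 V → ℝ) (M : Finset (Sym2 V)) : ℝ := ∑ e ∈ M, w e

/-- ν(G): the maximum weight of a matching of `G`. -/
noncomputable def nu (G : SimpleGraph V) (w : Sym2 V → ℝ) : ℝ :=
  sSup {r : ℝ | ∃ M : Finset (Sym2 V), IsMatching G M ∧ r = setWeight w M}

/-- A fractional matching of `G`. -/
def IsFracMatching (G : SimpleGraph V) (x : Sym2 V → ℝ) : Prop :=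
  (∀ e, 0 ≤ x e) ∧ (∀ e, e ∉ G.edgeSet → x e = 0) ∧ ∀ v : V, ∑ u : V, x s(v, u) ≤ 1

/-- The weight of a fractional matching. -/
noncomputable def fracWeight (w x : Sym2 V → ℝ) : ℝ := ∑ e : Sym2 V, w e * x e

/-- ν_f(G): the maximum weight of a fractional matching of `G`. -/
noncomputable def nuf (G : SimpleGraph V) (w : Sym2 V → ℝ) : ℝ :=
  sSup {r : ℝ | ∃ x : Sym2 V → ℝ, IsFracMatching G x ∧ r = fracWeight w x}

/-- A maximum-weight fractional matching of `G`. -/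
def IsMaxFracMatching (G : SimpleGraph V) (w x : Sym2 V → ℝ) : Prop :=
  IsFracMatching G x ∧ ∀ y : Sym2 V → ℝ, IsFracMatching G y → fracWeight w y ≤ fracWeight w x

/-- All entries lie in {0, 1/2, 1}. -/
def IsHalfIntegral (x : Sym2 V → ℝ) : Prop := ∀ e, x e = 0 ∨ x e = 1 / 2 ∨ x e = 1

/-- `C` is the edge set of an odd cycle of `G`. -/
def IsOddCycleEdgeSet (G : SimpleGraph V) (C : Finset (Sym2 V)) : Prop :=
  ∃ (v : V) (c : G.Walk v v), c.IsCycle ∧ Odd c.length ∧ c.edges.toFinset = C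

/-- `F` is the family 𝒞(x) of vertex-disjoint odd cycles carrying exactly the
half-valued edges of `x`. -/
def IsCycleFamily (G : SimpleGraph V) (x : Sym2 V → ℝ) (F : Finset (Finset (Sym2 V))) : Prop :=
  (∀ C ∈ F, IsOddCycleEdgeSet G C) ∧
  (∀ C ∈ F, ∀ D ∈ F, C ≠ D → Disjoint (edgeVerts C) (edgeVerts D)) ∧
  (∀ e : Sym2 V, x e = 1 / 2 ↔ ∃ C ∈ F, e ∈ C)

/-- A basic fractional matching of `G`. -/
def IsBasic (G : SimpleGraph V) (x : Sym2 V → ℝ) : Prop :=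
  IsFracMatching G x ∧ IsHalfIntegral x ∧ ∃ F, IsCycleFamily G x F

/-- γ(G): the minimum number of odd cycles in the support of a basic
maximum-weight fractional matching of `G`. -/
noncomputable def gamma (G : SimpleGraph V) (w : Sym2 V → ℝ) : ℕ :=
  sInf {n : ℕ | ∃ (x : Sym2 V → ℝ) (F : Finset (Finset (Sym2 V))),
    IsMaxFracMatching G w x ∧ IsHalfIntegral x ∧ IsCycleFamily G x F ∧ F.card = n}

/-- `G` is stable: ν(G) = ν_f(G). -/
def IsStable (G : SimpleGraph V) (w : Sym2 V → ℝ) : Prop := nu G w = nuf G w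

/-- Deletion of a set of vertices (as the spanning subgraph obtained by
removing all edges incident to `S`; matchings, fractional matchings and covers
of `G∖S` correspond to those of this graph). -/
def deleteVerts (G : SimpleGraph V) (S : Set V) : SimpleGraph V where
  Adj a b := G.Adj a b ∧ a ∉ S ∧ b ∉ S
  symm := ⟨fun _ _ h => ⟨h.1.symm, h.2.2, h.2.1⟩⟩
  loopless := ⟨fun a h => G.loopless.irrefl a h.1⟩

/-- A fractional w-vertex cover of `G`. -/
def IsFracCover (G : SimpleGraph V) (w : Sym2 V → ℝ) (y : V → ℝ) : Prop :=
  (∀ v, 0 ≤ y v) ∧ ∀ a b : V, G.Adj a b → w s(a, b) ≤ y a + y b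

noncomputable def coverValue (y : V → ℝ) : ℝ := ∑ v : V, y v

/-- A minimum fractional w-vertex cover of `G`. -/
def IsMinFracCover (G : SimpleGraph V) (w : Sym2 V → ℝ) (y : V → ℝ) : Prop :=
  IsFracCover G w y ∧ ∀ z : V → ℝ, IsFracCover G w z → coverValue y ≤ coverValue z

/-- M(x): the 1-valued edges of `x`. -/
noncomputable def oneEdges (x : Sym2 V → ℝ) : Finset (Sym2 V) :=
  Finset.univ.filter fun e => x e = 1

/-- `v` is exposed by the matching `M`. -/
def MExposed (M : Finset (Sym2 V)) (v : V) : Prop := ∀ e ∈ M, v ∉ e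

/-- A list of edges alternately in and out of `M`. -/
def AltList (M : Finset (Sym2 V)) (l : List (Sym2 V)) : Prop :=
  l.Chain' fun e f => (e ∈ M ↔ f ∉ M)

variable {G : SimpleGraph V}

/-- An M-alternating walk. -/
def IsAltWalk (M : Finset (Sym2 V)) {a b : V} (p : G.Walk a b) : Prop := AltList M p.edges

/-- A valid walk: it starts (resp. ends) with an M-exposed vertex or an edge of `M`. -/
def IsValidWalk (M : Finset (Sym2 V)) {a b : V} (p : G.Walk a b) : Prop :=
  (MExposed M a ∨ ∃ e ∈ M, p.edges.head? = some e) ∧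
  (MExposed M b ∨ ∃ e ∈ M, p.edges.getLast? = some e)

/-- w(P ∩ M), with multiplicity. -/
noncomputable def wIn (w : Sym2 V → ℝ) (M : Finset (Sym2 V)) (l : List (Sym2 V)) : ℝ :=
  (l.map fun e => if e ∈ M then w e else 0).sum

/-- w(P ∖ M), with multiplicity. -/
noncomputable def wOut (w : Sym2 V → ℝ) (M : Finset (Sym2 V)) (l : List (Sym2 V)) : ℝ :=
  (l.map fun e => if e ∈ M then 0 else w e).sum

/-- An M-augmenting walk. -/
def IsAugWalk (w : Sym2 V → ℝ) (M : Finset (Sym2 V)) {a b : V} (p : G.Walk a b) : Prop :=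
  IsAltWalk M p ∧ IsValidWalk M p ∧ wIn w M p.edges < wOut w M p.edges

/-- An M-augmenting path. -/
def IsAugPath (w : Sym2 V → ℝ) (M : Finset (Sym2 V)) {a b : V} (p : G.Walk a b) : Prop :=
  p.IsPath ∧ IsAugWalk w M p

/-- An M-alternating cycle (an even cycle alternately in and out of `M`). -/
def IsAltCycle (M : Finset (Sym2 V)) {a : V} (c : G.Walk a a) : Prop :=
  c.IsCycle ∧ Even c.length ∧ AltList M c.edges ∧
  ∀ e f : Sym2 V, c.edges.head? = some e → c.edges.getLast? = some f → (e ∈ M ↔ f ∉ M)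

/-- An M-augmenting cycle. -/
def IsAugCycle (w : Sym2 V → ℝ) (M : Finset (Sym2 V)) {a : V} (c : G.Walk a a) : Prop :=
  IsAltCycle M c ∧ wIn w M c.edges < wOut w M c.edges

/-- An M-blossom with base `a` (traversed starting and ending at its base). -/
def IsBlossom (M : Finset (Sym2 V)) {a : V} (c : G.Walk a a) : Prop :=
  c.IsCycle ∧ Odd c.length ∧ AltList M c.edges ∧
  ∀ e : Sym2 V, c.edges.head? = some e → e ∉ M

/-- An M-flower: an M-blossom `c` with base `a` together with a valid M-alternating
path `p` from the base `a` to the root `r`, starting with an edge of `M`. -/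
def IsFlower (M : Finset (Sym2 V)) {a r : V} (c : G.Walk a a) (p : G.Walk a r) : Prop :=
  IsBlossom M c ∧ p.IsPath ∧ AltList M p.edges ∧
  (∃ e ∈ M, p.edges.head? = some e) ∧
  (MExposed M r ∨ ∃ e ∈ M, p.edges.getLast? = some e)

/-- An M-augmenting flower (with root `r`). -/
def IsAugFlower (w : Sym2 V → ℝ) (M : Finset (Sym2 V)) {a r : V}
    (c : G.Walk a a) (p : G.Walk a r) : Prop :=
  IsFlower M c p ∧
  wIn w M c.edges + 2 * wIn w M p.edges < wOut w M c.edges + 2 * wOut w M p.edges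

/-- An M-bi-cycle: two M-blossoms `c`, `d` with bases `a`, `b` joined by an odd
M-alternating path `p` starting and ending with edges of `M`. -/
def IsBicycle (M : Finset (Sym2 V)) {a b : V}
    (c : G.Walk a a) (p : G.Walk a b) (d : G.Walk b b) : Prop :=
  IsBlossom M c ∧ IsBlossom M d ∧ p.IsPath ∧ Odd p.length ∧ AltList M p.edges ∧
  (∃ e ∈ M, p.edges.head? = some e) ∧ (∃ e ∈ M, p.edges.getLast? = some e)

/-- An M-augmenting bi-cycle. -/
def IsAugBicycle (w : Sym2 V → ℝ) (M : Finset (Sym2 V)) {a b : V}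
    (c : G.Walk a a) (p : G.Walk a b) (d : G.Walk b b) : Prop :=
  IsBicycle M c p d ∧
  wIn w M c.edges + 2 * wIn w M p.edges + wIn w M d.edges <
    wOut w M c.edges + 2 * wOut w M p.edges + wOut w M d.edges

/-- All edges of the walk are tight with respect to the fractional vertex cover `y`. -/
def IsTightWalk (w : Sym2 V → ℝ) (y : V → ℝ) {a b : V} (p : G.Walk a b) : Prop :=
  ∀ d ∈ p.darts, y d.toProd.1 + y d.toProd.2 = w s(d.toProd.1, d.toProd.2)

/-- `x'` is the result of alternate rounding on the odd cycle with edge set `C`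
at the vertex `u`: on `C` it is 0/1-valued, both edges of `C` at `u` get value 0,
and its 1-valued edges inside `C` perfectly match the remaining vertices of `C`. -/
def AltRoundedOn (x' : Sym2 V → ℝ) (C : Finset (Sym2 V)) (u : V) : Prop :=
  (∀ e ∈ C, x' e = 0 ∨ x' e = 1) ∧ (∀ e ∈ C, u ∈ e → x' e = 0) ∧
  ∀ z ∈ edgeVerts C, z ≠ u → ∃! e : Sym2 V, e ∈ C ∧ x' e = 1 ∧ z ∈ e


omit [DecidableEq V] in
theorem sameCycle_mem_of_forall {θ : Equiv.Perm V} {P : V → Prop} (hP : ∀ x, P x → P (θ x))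
    {x y : V} (h : θ.SameCycle x y) (hx : P x) : P y := by
  obtain ⟨n, rfl⟩ := h.exists_nat_pow_eq
  induction n with
  | zero => simpa using hx
  | succ n ih => rw [pow_succ', Equiv.Perm.mul_apply]; exact hP _ (ih ⟨n, by simp⟩)

/-- The orbit of a point under a permutation, as a finset. -/
def orb (θ : Equiv.Perm V) (x : V) : Finset V := Finset.univ.filter (θ.SameCycle x)

@[simp]
theorem mem_orb {θ : Equiv.Perm V} {x y : V} : y ∈ orb θ x ↔ θ.SameCycle x y := by
  simp [orb]

theorem self_mem_orb (θ : Equiv.Perm V) (x : V) : x ∈ orb θ x := by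
  simp [Equiv.Perm.SameCycle.refl]

theorem orb_eq_iff {θ : Equiv.Perm V} {x y : V} : orb θ x = orb θ y ↔ θ.SameCycle x y := by
  constructor
  · intro h
    have := self_mem_orb θ y
    rwa [← h, mem_orb] at this
  · intro h
    ext z
    simp only [mem_orb]
    exact ⟨h.symm.trans, h.trans⟩

theorem orb_disjoint {θ : Equiv.Perm V} {x y : V} (h : ¬ θ.SameCycle x y) :
    Disjoint (orb θ x) (orb θ y) := by
  rw [Finset.disjoint_left]
  intro z hx hy
  exact h ((mem_orb.1 hx).trans (mem_orb.1 hy).symm)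

theorem orb_card_pos (θ : Equiv.Perm V) (x : V) : 0 < (orb θ x).card :=
  Finset.card_pos.2 ⟨x, self_mem_orb θ x⟩

omit [Fintype V] in
theorem mul_swap_apply_of_ne {θ : Equiv.Perm V} {z p x : V} (hz : x ≠ z) (hp : x ≠ p) :
    (θ * Equiv.swap z p) x = θ x := by
  rw [Equiv.Perm.mul_apply, Equiv.swap_apply_of_ne_of_ne hz hp]

omit [Fintype V] in
@[simp]
theorem mul_swap_apply_left (θ : Equiv.Perm V) (z p : V) :
    (θ * Equiv.swap z p) z = θ p := by simp

omit [Fintype V] in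
@[simp]
theorem mul_swap_apply_right (θ : Equiv.Perm V) (z p : V) :
    (θ * Equiv.swap z p) p = θ z := by simp

theorem orb_mul_swap_of_not_sameCycle {θ : Equiv.Perm V} {z p x : V}
    (hz : ¬ θ.SameCycle x z) (hp : ¬ θ.SameCycle x p) :
    orb (θ * Equiv.swap z p) x = orb θ x := by
  have key : ∀ y, θ.SameCycle x y → (θ * Equiv.swap z p) y = θ y := by
    intro y hy
    apply mul_swap_apply_of_ne
    · rintro rfl; exact hz hy
    · rintro rfl; exact hp hy
  ext y
  simp only [mem_orb]
  constructor
  · intro h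
    refine sameCycle_mem_of_forall (P := fun y => θ.SameCycle x y) ?_ h
      (Equiv.Perm.SameCycle.refl _ _)
    intro y hy
    rw [key y hy]
    exact Equiv.Perm.sameCycle_apply_right.2 hy
  · intro h
    refine (sameCycle_mem_of_forall (θ := θ)
      (P := fun y => θ.SameCycle x y ∧ (θ * Equiv.swap z p).SameCycle x y) ?_ h
      ⟨Equiv.Perm.SameCycle.refl _ _, Equiv.Perm.SameCycle.refl _ _⟩).2
    rintro y ⟨hy, hy'⟩
    refine ⟨Equiv.Perm.sameCycle_apply_right.2 hy, ?_⟩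
    rw [← key y hy]
    exact Equiv.Perm.sameCycle_apply_right.2 hy'

theorem sameCycle_mul_swap_of_not {θ : Equiv.Perm V} {z p : V} (h : ¬ θ.SameCycle z p) :
    (θ * Equiv.swap z p).SameCycle z p := by
  have hq : θ.SameCycle p (θ⁻¹ p) := ⟨-1, by simp⟩
  have := (sameCycle_mem_of_forall (θ := θ)
    (P := fun y => θ.SameCycle p y ∧ (θ * Equiv.swap z p).SameCycle z (θ y)) ?_ hq
    ⟨Equiv.Perm.SameCycle.refl _ _, ?_⟩).2
  · simpa using this
  · rintro y ⟨hy, hy'⟩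
    refine ⟨Equiv.Perm.sameCycle_apply_right.2 hy, ?_⟩
    by_cases hyp : θ y = p
    · rw [hyp, ← mul_swap_apply_left θ z p]
      exact Equiv.Perm.sameCycle_apply_right.2 (Equiv.Perm.SameCycle.refl _ _)
    · rw [← mul_swap_apply_of_ne (θ := θ) (z := z) _ hyp]
      · exact Equiv.Perm.sameCycle_apply_right.2 hy'
      · intro hz
        exact h (hz ▸ Equiv.Perm.sameCycle_apply_right.2 hy).symm
  · rw [← mul_swap_apply_left θ z p]
    exact Equiv.Perm.sameCycle_apply_right.2 (Equiv.Perm.SameCycle.refl _ _)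

theorem not_sameCycle_mul_swap {θ : Equiv.Perm V} {z p : V} (hne : p ≠ z)
    (h : θ.SameCycle z p) : ¬ (θ * Equiv.swap z p).SameCycle p z := by
  have hex : ∃ n : ℕ, (θ ^ n) z = p := h.exists_nat_pow_eq
  have hn := Nat.find_spec hex
  have hmin := fun m (hm : m < Nat.find hex) => Nat.find_min hex hm
  set n := Nat.find hex
  have hz : ∀ k, 1 ≤ k → k ≤ n → (θ ^ k) z ≠ z := by
    intro k h1 hk hkz
    apply hmin (n - k) (by omega)
    calc (θ ^ (n - k)) z = (θ ^ (n - k)) ((θ ^ k) z) := by rw [hkz]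
      _ = (θ ^ n) z := by rw [← Equiv.Perm.mul_apply, ← pow_add, Nat.sub_add_cancel hk]
      _ = p := hn
  have hn0 : 1 ≤ n := by
    rcases Nat.eq_zero_or_pos n with h0 | h0
    · rw [h0] at hn; exact absurd hn.symm (by simpa using hne)
    · exact h0
  intro hc
  have hstep : ∀ y, (∃ k, 1 ≤ k ∧ k ≤ n ∧ (θ ^ k) z = y) →
      ∃ k, 1 ≤ k ∧ k ≤ n ∧ (θ ^ k) z = (θ * Equiv.swap z p) y := by
    rintro y ⟨k, h1, hk, rfl⟩
    rcases hk.lt_or_eq with hk' | hk'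
    · refine ⟨k + 1, by omega, hk', ?_⟩
      rw [mul_swap_apply_of_ne (hz k h1 hk) (hmin k hk'), pow_succ', Equiv.Perm.mul_apply]
    · exact ⟨1, le_rfl, hn0, by rw [hk', hn, mul_swap_apply_right, pow_one]⟩
  obtain ⟨k, h1, hk, hkz⟩ := sameCycle_mem_of_forall hstep hc ⟨n, hn0, le_rfl, hn⟩
  exact hz k h1 hk hkz

omit [Fintype V] in
theorem mul_swap_mul_swap (θ : Equiv.Perm V) (z p : V) :
    θ * Equiv.swap z p * Equiv.swap z p = θ := by
  rw [mul_assoc, Equiv.swap_mul_self, mul_one]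

theorem sameCycle_or_mul_swap {θ : Equiv.Perm V} {z p x : V}
    (h : θ.SameCycle z x ∨ θ.SameCycle p x) :
    (θ * Equiv.swap z p).SameCycle z x ∨ (θ * Equiv.swap z p).SameCycle p x := by
  by_contra hc
  push Not at hc
  have := orb_mul_swap_of_not_sameCycle (θ := θ * Equiv.swap z p) (z := z) (p := p) (x := x)
    (fun h => hc.1 h.symm) (fun h => hc.2 h.symm)
  rw [mul_swap_mul_swap] at this
  rcases h with h | h
  · exact hc.1 (mem_orb.1 (this ▸ mem_orb.2 h.symm)).symm
  · exact hc.2 (mem_orb.1 (this ▸ mem_orb.2 h.symm)).symm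

theorem orb_union_mul_swap (θ : Equiv.Perm V) (z p : V) :
    orb (θ * Equiv.swap z p) z ∪ orb (θ * Equiv.swap z p) p = orb θ z ∪ orb θ p := by
  ext x
  simp only [Finset.mem_union, mem_orb]
  refine ⟨fun h => ?_, sameCycle_or_mul_swap⟩
  have := sameCycle_or_mul_swap h
  rwa [mul_swap_mul_swap] at this

theorem orb_mul_swap_of_ne {θ : Equiv.Perm V} {z p x : V}
    (hz : x ∉ orb (θ * Equiv.swap z p) z) (hp : x ∉ orb (θ * Equiv.swap z p) p) :
    orb (θ * Equiv.swap z p) x = orb θ x ∧ x ∉ orb θ z ∧ x ∉ orb θ p := by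
  have h : x ∉ orb θ z ∪ orb θ p := by
    rw [← orb_union_mul_swap]; simp only [Finset.mem_union, not_or]; exact ⟨hz, hp⟩
  simp only [Finset.mem_union, not_or] at h
  refine ⟨orb_mul_swap_of_not_sameCycle ?_ ?_, h⟩
  · exact fun h' => h.1 (mem_orb.2 h'.symm)
  · exact fun h' => h.2 (mem_orb.2 h'.symm)

/-- Multiplying by a transposition merges two distinct orbits. -/
theorem orb_mul_swap_merge {θ : Equiv.Perm V} {z p : V} (h : ¬ θ.SameCycle z p) :
    orb (θ * Equiv.swap z p) p = orb (θ * Equiv.swap z p) z ∧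
    (orb (θ * Equiv.swap z p) p).card = (orb θ z).card + (orb θ p).card := by
  have h1 : orb (θ * Equiv.swap z p) p = orb (θ * Equiv.swap z p) z :=
    (orb_eq_iff.2 (sameCycle_mul_swap_of_not h)).symm
  refine ⟨h1, ?_⟩
  rw [← Finset.card_union_of_disjoint (orb_disjoint h), ← orb_union_mul_swap, ← h1,
    Finset.union_self]

/-- Multiplying by a transposition splits an orbit. -/
theorem orb_mul_swap_split {θ : Equiv.Perm V} {z p : V} (hne : p ≠ z) (h : θ.SameCycle z p) :
    ¬ (θ * Equiv.swap z p).SameCycle p z ∧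
    (orb (θ * Equiv.swap z p) z).card + (orb (θ * Equiv.swap z p) p).card = (orb θ z).card := by
  have h1 := not_sameCycle_mul_swap hne h
  refine ⟨h1, ?_⟩
  rw [← Finset.card_union_of_disjoint (orb_disjoint fun h => h1 h.symm), orb_union_mul_swap,
    orb_eq_iff.2 h, Finset.union_self]

/-- The orbits of odd size at least three. -/
def oddOrbs (θ : Equiv.Perm V) : Finset (Finset V) :=
  (Finset.univ.image (orb θ)).filter fun D => 3 ≤ D.card ∧ Odd D.card

theorem mem_oddOrbs {θ : Equiv.Perm V} {D : Finset V} :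
    D ∈ oddOrbs θ ↔ (∃ x, orb θ x = D) ∧ 3 ≤ D.card ∧ Odd D.card := by
  simp [oddOrbs]

theorem mem_oddOrbs_of_mul_swap {θ : Equiv.Perm V} {z p : V} {D : Finset V}
    (hD : D ∈ oddOrbs (θ * Equiv.swap z p))
    (hz : D ≠ orb (θ * Equiv.swap z p) z) (hp : D ≠ orb (θ * Equiv.swap z p) p) :
    D ∈ (oddOrbs θ).erase (orb θ z) := by
  obtain ⟨⟨x, rfl⟩, hD⟩ := mem_oddOrbs.1 hD
  obtain ⟨h1, h2, h3⟩ := orb_mul_swap_of_ne (θ := θ) (z := z) (p := p) (x := x)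
    (fun h => hz (orb_eq_iff.2 (mem_orb.1 h).symm)) (fun h => hp (orb_eq_iff.2 (mem_orb.1 h).symm))
  rw [Finset.mem_erase, mem_oddOrbs, h1]
  refine ⟨fun h => h2 (h ▸ self_mem_orb θ x), ⟨x, rfl⟩, h1 ▸ hD⟩

omit [Fintype V] [DecidableEq V] in
theorem sameCycle_apply (θ : Equiv.Perm V) (x : V) : θ.SameCycle x (θ x) :=
  Equiv.Perm.sameCycle_apply_right.2 (Equiv.Perm.SameCycle.refl _ _)

theorem orb_subset_pair {θ : Equiv.Perm V} {x : V} (h : θ (θ x) = x) : orb θ x ⊆ {x, θ x} := by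
  intro y hy
  refine sameCycle_mem_of_forall (P := fun y => y ∈ ({x, θ x} : Finset V)) ?_ (mem_orb.1 hy)
    (by simp)
  intro y hy
  simp only [Finset.mem_insert, Finset.mem_singleton] at hy ⊢
  rcases hy with rfl | rfl
  · exact Or.inr rfl
  · exact Or.inl h

theorem orb_card_le_two {θ : Equiv.Perm V} {x : V} (h : θ (θ x) = x) : (orb θ x).card ≤ 2 :=
  (Finset.card_le_card (orb_subset_pair h)).trans Finset.card_le_two

theorem orb_of_fixed {θ : Equiv.Perm V} {x : V} (h : θ x = x) : orb θ x = {x} := by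
  apply Finset.Subset.antisymm
  · simpa [h] using orb_subset_pair (θ := θ) (x := x) (by rw [h, h])
  · simpa using self_mem_orb θ x

theorem three_le_orb_card {θ : Equiv.Perm V} {x : V} (h : θ (θ x) ≠ x) :
    3 ≤ (orb θ x).card := by
  have hx : θ x ≠ x := fun h' => h (by rw [h', h'])
  have h3 : ({x, θ x, θ (θ x)} : Finset V).card = 3 :=
    Finset.card_eq_three.2 ⟨_, _, _, hx.symm, h.symm, fun h' => hx (θ.injective h').symm, rfl⟩
  rw [← h3]
  apply Finset.card_le_card
  intro y hy
  simp only [Finset.mem_insert, Finset.mem_singleton] at hy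
  rcases hy with rfl | rfl | rfl
  · exact self_mem_orb _ _
  · exact mem_orb.2 (sameCycle_apply _ _)
  · exact mem_orb.2 ((sameCycle_apply _ _).trans (sameCycle_apply _ _))

/-- An even orbit all of whose arcs but one are present can be split into
transpositions using the arcs in both directions. -/
theorem exists_split_even {A : V → V → Prop} (hA : ∀ x y, A x y → A y x) (θ : Equiv.Perm V)
    (z : V) (hθ : ∀ x, x ≠ z → A x (θ x)) (hz : Even (orb θ z).card) :
    ∃ θ' : Equiv.Perm V, (∀ x, A x (θ' x)) ∧
      ∀ x, (x ∉ orb θ z ∧ orb θ' x = orb θ x) ∨ (x ∈ orb θ z ∧ (orb θ' x).card = 2) := by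
  induction hn : (orb θ z).card using Nat.strong_induction_on generalizing θ with
  | _ n ih =>
  by_cases h2 : θ (θ z) = z
  · have hc : (orb θ z).card = 2 := by
      have := orb_card_le_two h2
      have := orb_card_pos θ z
      obtain ⟨k, hk⟩ := hz
      omega
    refine ⟨θ, fun x => ?_, fun x => ?_⟩
    · by_cases hx : x = z
      · subst hx
        have hne : θ x ≠ x := fun h => by simp [orb_of_fixed h] at hc
        have := hA _ _ (hθ (θ x) hne)
        rwa [h2] at this
      · exact hθ x hx
    · by_cases hx : x ∈ orb θ z
      · exact Or.inr ⟨hx, by rw [← orb_eq_iff.2 (mem_orb.1 hx), hc]⟩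
      · exact Or.inl ⟨hx, rfl⟩
  · set q := θ (θ z) with hq
    have hz1 : θ z ≠ z := fun h => h2 (by rw [hq, h, h])
    have hq1 : q ≠ θ z := fun h => hz1 (θ.injective h)
    have hsc : θ.SameCycle z q := (sameCycle_apply _ _).trans (sameCycle_apply _ _)
    obtain ⟨hns, hcard⟩ := orb_mul_swap_split h2 hsc
    set θ₁ := θ * Equiv.swap z q with hθ₁
    have hq2 : θ₁ q = θ z := mul_swap_apply_right _ _ _
    have hq3 : θ₁ (θ z) = q := mul_swap_apply_of_ne hz1 hq1.symm
    have hqc : (orb θ₁ q).card = 2 := by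
      apply le_antisymm (orb_card_le_two (by rw [hq2, hq3]))
      rw [← Finset.card_pair hq1]
      apply Finset.card_le_card
      intro y hy
      simp only [Finset.mem_insert, Finset.mem_singleton] at hy
      rcases hy with rfl | rfl
      · exact self_mem_orb _ _
      · rw [← hq2]; exact mem_orb.2 (sameCycle_apply _ _)
    have hun := orb_union_mul_swap θ z q
    rw [← hθ₁, orb_eq_iff.2 hsc.symm, Finset.union_self] at hun
    obtain ⟨θ', h1, h3⟩ := ih (orb θ₁ z).card (by omega) θ₁ (fun x hx => by
      by_cases hxq : x = q
      · rw [hxq, hq2]; exact hA _ _ (hθ _ hz1)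
      · rw [hθ₁, mul_swap_apply_of_ne hx hxq]; exact hθ x hx) (by
      have : Even ((orb θ₁ z).card + 2) := by rw [← hqc, hcard]; exact hz
      simpa [Nat.even_add] using this) rfl
    refine ⟨θ', h1, fun x => ?_⟩
    rcases h3 x with ⟨hx, hx'⟩ | ⟨hx, hx'⟩
    · by_cases hxq : x ∈ orb θ₁ q
      · refine Or.inr ⟨hun ▸ Finset.mem_union_right _ hxq, ?_⟩
        rw [hx', ← orb_eq_iff.2 (mem_orb.1 hxq), hqc]
      · have := orb_mul_swap_of_ne (θ := θ) hx hxq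
        exact Or.inl ⟨this.2.1, hx'.trans this.1⟩
    · exact Or.inr ⟨hun ▸ Finset.mem_union_left _ hx, hx'⟩

theorem exists_split_even_oddOrbs {A : V → V → Prop} (hA : ∀ x y, A x y → A y x)
    (θ : Equiv.Perm V) (z : V) (hθ : ∀ x, x ≠ z → A x (θ x)) (hz : Even (orb θ z).card) :
    ∃ θ' : Equiv.Perm V, (∀ x, A x (θ' x)) ∧ oddOrbs θ' ⊆ oddOrbs θ := by
  obtain ⟨θ', h1, h2⟩ := exists_split_even hA θ z hθ hz
  refine ⟨θ', h1, fun D hD => ?_⟩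
  obtain ⟨⟨x, rfl⟩, h3, h4⟩ := mem_oddOrbs.1 hD
  rcases h2 x with ⟨_, h⟩ | ⟨_, h⟩
  · exact mem_oddOrbs.2 ⟨⟨x, h.symm⟩, h3, h4⟩
  · omega

/-- A permutation respecting `A` outside one point of an odd orbit can be completed, given
some permutation respecting `A`, at the cost of at most one further odd orbit. -/
theorem exists_completion {A : V → V → Prop} (hA : ∀ x y, A x y → A y x)
    (τ : Equiv.Perm V) (hτ : ∀ x, A x (τ x)) (θ : Equiv.Perm V) (z : V)
    (hθ : ∀ x, x ≠ z → A x (θ x)) (hz : Odd (orb θ z).card) (b : ℕ)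
    (hb : ((oddOrbs θ).erase (orb θ z)).card ≤ b) :
    ∃ θ' : Equiv.Perm V, (∀ x, A x (θ' x)) ∧ (oddOrbs θ').card ≤ b + 1 := by
  induction hn : (Finset.univ.filter fun x => θ x ≠ τ x).card using Nat.strong_induction_on
    generalizing θ z with
  | _ n ih =>
  have hτp : θ (θ⁻¹ (τ z)) = τ z := by simp
  set p := θ⁻¹ (τ z) with hp
  by_cases hpz : p = z
  · refine ⟨θ, fun x => ?_, ?_⟩
    · by_cases hx : x = z
      · rw [hx]; nth_rw 2 [← hpz]; rw [hτp]; exact hτ z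
      · exact hθ x hx
    · have := Finset.pred_card_le_card_erase (s := oddOrbs θ) (a := orb θ z)
      omega
  set θ₁ := θ * Equiv.swap z p with hθ₁
  have hz1 : θ₁ z = τ z := by rw [hθ₁, mul_swap_apply_left, hτp]
  have harc : ∀ x, x ≠ p → A x (θ₁ x) := by
    intro x hx
    by_cases hxz : x = z
    · rw [hxz, hz1]; exact hτ z
    · rw [hθ₁, mul_swap_apply_of_ne hxz hx]; exact hθ x hxz
  have hmeas : (Finset.univ.filter fun x => θ₁ x ≠ τ x).card < n := by
    rw [← hn]
    apply Finset.card_lt_card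
    rw [Finset.ssubset_iff_of_subset]
    · refine ⟨z, ?_, by simp [hz1]⟩
      simp only [Finset.mem_filter, Finset.mem_univ, true_and]
      intro h
      exact hpz (θ.injective (hτp.trans h.symm))
    · intro x
      simp only [Finset.mem_filter, Finset.mem_univ, true_and]
      intro hx
      have hxz : x ≠ z := fun h => hx (h ▸ hz1)
      by_cases hxp : x = p
      · rw [hxp, hτp]; exact fun h => hpz (τ.injective h).symm
      · rwa [hθ₁, mul_swap_apply_of_ne hxz hxp] at hx
  by_cases hsc : θ.SameCycle z p
  · obtain ⟨hns, hcard⟩ := orb_mul_swap_split hpz hsc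
    rw [← hθ₁] at hns hcard
    rcases Nat.even_or_odd (orb θ₁ p).card with hev | hodd
    · obtain ⟨θ', h1, h2⟩ := exists_split_even_oddOrbs hA θ₁ p harc hev
      refine ⟨θ', h1, (Finset.card_le_card (h2.trans ?_)).trans
        ((Finset.card_insert_le (orb θ₁ z) ((oddOrbs θ).erase (orb θ z))).trans (by omega))⟩
      intro D hD
      rw [Finset.mem_insert]
      by_cases hDz : D = orb θ₁ z
      · exact Or.inl hDz
      · refine Or.inr (mem_oddOrbs_of_mul_swap hD hDz ?_)
        rintro rfl
        exact Nat.not_even_iff_odd.2 (mem_oddOrbs.1 hD).2.2 hev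
    · have hev : Even (orb θ₁ z).card := by
        rw [← hcard, Nat.odd_add] at hz
        by_contra h
        exact Nat.not_even_iff_odd.2 hodd (hz.1 (Nat.not_even_iff_odd.1 h))
      refine ih _ hmeas θ₁ p harc hodd ((Finset.card_le_card ?_).trans hb) rfl
      intro D hD
      rw [Finset.mem_erase] at hD
      refine mem_oddOrbs_of_mul_swap hD.2 ?_ hD.1
      rintro rfl
      exact Nat.not_even_iff_odd.2 (mem_oddOrbs.1 hD.2).2.2 hev
  · obtain ⟨heq, hcard⟩ := orb_mul_swap_merge hsc
    rw [← hθ₁] at heq hcard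
    have hsub : (oddOrbs θ₁).erase (orb θ₁ p) ⊆ (oddOrbs θ).erase (orb θ z) := by
      intro D hD
      rw [Finset.mem_erase] at hD
      exact mem_oddOrbs_of_mul_swap hD.2 (heq ▸ hD.1) hD.1
    rcases Nat.even_or_odd (orb θ₁ p).card with hev | hodd
    · obtain ⟨θ', h1, h2⟩ := exists_split_even_oddOrbs hA θ₁ p harc hev
      have hni : orb θ₁ p ∉ oddOrbs θ₁ := fun h =>
        Nat.not_even_iff_odd.2 (mem_oddOrbs.1 h).2.2 hev
      rw [Finset.erase_eq_of_notMem hni] at hsub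
      have := Finset.card_le_card (h2.trans hsub)
      exact ⟨θ', h1, by omega⟩
    · exact ih _ hmeas θ₁ p harc hodd ((Finset.card_le_card hsub).trans hb) rfl

/-- The total weight of the arcs of a permutation. -/
def permWeight (W : V → V → ℝ) (ρ : Equiv.Perm V) : ℝ := ∑ a, W a (ρ a)

/-- A permutation of maximum weight. -/
def IsOpt (W : V → V → ℝ) (ρ : Equiv.Perm V) : Prop := ∀ σ, permWeight W σ ≤ permWeight W ρ

omit [DecidableEq V] in
theorem exists_isOpt (W : V → V → ℝ) : ∃ ρ, IsOpt W ρ :=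
  Finite.exists_max (permWeight W)

omit [DecidableEq V] in
theorem IsOpt.permWeight_eq {W : V → V → ℝ} {ρ τ : Equiv.Perm V} (hρ : IsOpt W ρ)
    (hτ : IsOpt W τ) : permWeight W ρ = permWeight W τ :=
  le_antisymm (hτ _) (hρ _)

omit [DecidableEq V] in
theorem IsOpt.of_permWeight_le {W : V → V → ℝ} {ρ τ : Equiv.Perm V} (hρ : IsOpt W ρ)
    (h : permWeight W ρ ≤ permWeight W τ) : IsOpt W τ :=
  fun σ => (hρ σ).trans h

omit [DecidableEq V] in
theorem permWeight_inv {W : V → V → ℝ} (hW : ∀ a b, W a b = W b a) (ρ : Equiv.Perm V) :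
    permWeight W ρ⁻¹ = permWeight W ρ := by
  unfold permWeight
  rw [← Equiv.sum_comp ρ]
  exact Finset.sum_congr rfl fun a _ => by simp [hW]

omit [DecidableEq V] in
theorem IsOpt.inv {W : V → V → ℝ} (hW : ∀ a b, W a b = W b a) {ρ : Equiv.Perm V}
    (hρ : IsOpt W ρ) : IsOpt W ρ⁻¹ :=
  hρ.of_permWeight_le (permWeight_inv hW ρ).ge

theorem sum_permMatrix (W : V → V → ℝ) (σ : Equiv.Perm V) :
    ∑ i, ∑ j, W i j * (if σ i = j then 1 else 0) = permWeight W σ := by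
  simp [permWeight]

omit [DecidableEq V] in
theorem sum_sum_mul_sum {ι : Type*} [Fintype ι] (W : V → V → ℝ) (c : ι → ℝ) (f : ι → V → V → ℝ) :
    ∑ i, ∑ j, W i j * ∑ k, c k * f k i j = ∑ k, c k * ∑ i, ∑ j, W i j * f k i j := by
  simp_rw [Finset.mul_sum]
  rw [Finset.sum_comm_cycle]
  simp_rw [mul_left_comm]

/-- Birkhoff's theorem, as a bound on linear functionals. -/
theorem sum_mul_le_of_permWeight_le {W X : V → V → ℝ} {s M : ℝ} (hs : 0 ≤ s)
    (h0 : ∀ i j, 0 ≤ X i j) (hr : ∀ i, ∑ j, X i j = s) (hc : ∀ j, ∑ i, X i j = s)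
    (hM : ∀ σ, permWeight W σ ≤ M) : ∑ i, ∑ j, W i j * X i j ≤ s * M := by
  obtain ⟨Y, hY, hXY⟩ := (exists_mem_doublyStochastic_eq_smul_iff (M := Matrix.of X) hs).2
    ⟨h0, hr, hc⟩
  obtain ⟨c, hc0, hc1, rfl⟩ := exists_eq_sum_perm_of_mem_doublyStochastic hY
  have hX : ∀ i j, X i j = s * ∑ σ : Equiv.Perm V, c σ * (if σ i = j then 1 else 0) := by
    intro i j
    have := congrFun (congrFun hXY i) j
    simpa [Matrix.sum_apply, PEquiv.toMatrix_apply, Equiv.toPEquiv_apply] using this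
  calc ∑ i, ∑ j, W i j * X i j
      = s * ∑ σ : Equiv.Perm V, c σ * permWeight W σ := by
        simp_rw [hX, ← sum_permMatrix W, ← sum_sum_mul_sum, Finset.mul_sum, mul_left_comm]
    _ ≤ s * ∑ σ : Equiv.Perm V, c σ * M :=
        mul_le_mul_of_nonneg_left
          (Finset.sum_le_sum fun σ _ => mul_le_mul_of_nonneg_left (hM σ) (hc0 σ)) hs
    _ = s * M := by rw [← Finset.sum_mul, hc1, one_mul]

/-- A permutation all of whose arcs occur in optimal permutations is optimal. -/
theorem isOpt_of_arcs {W : V → V → ℝ} {ρ : Equiv.Perm V}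
    (h : ∀ x, ∃ π, IsOpt W π ∧ π x = ρ x) : IsOpt W ρ := by
  rcases isEmpty_or_nonempty V with hV | hV
  · exact fun σ => (congrArg _ (Subsingleton.elim _ _)).le
  choose π hopt hπ using h
  obtain ⟨o⟩ := hV
  have hn : (1 : ℝ) ≤ Fintype.card V := by
    exact_mod_cast Fintype.card_pos_iff.2 ⟨o⟩
  have hb := sum_mul_le_of_permWeight_le (W := W) (s := Fintype.card V - 1)
    (X := fun i j => ∑ a, (if π a i = j then 1 else 0) - (if ρ i = j then 1 else 0))
    (M := permWeight W (π o)) (by linarith) ?_ ?_ ?_ (hopt o)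
  · have h1 : ∑ i, ∑ j, W i j * (∑ a, (if π a i = j then 1 else 0) - (if ρ i = j then 1 else 0))
        = Fintype.card V * permWeight W (π o) - permWeight W ρ := by
      have h2 : Fintype.card V * permWeight W (π o) = ∑ a, permWeight W (π a) := by
        rw [Finset.sum_congr rfl fun a _ => (hopt a).permWeight_eq (hopt o)]
        simp
      rw [h2, ← sum_permMatrix W ρ]
      have h3 := sum_sum_mul_sum W (fun _ : V => 1) fun a i j => if π a i = j then 1 else 0
      simp only [one_mul] at h3
      simp_rw [mul_sub, Finset.sum_sub_distrib, h3, sum_permMatrix]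
    refine (hopt o).of_permWeight_le ?_
    linarith
  · intro i j
    rw [sub_nonneg]
    split_ifs with hij
    · refine le_trans ?_ (Finset.single_le_sum (f := fun a => if π a i = j then (1 : ℝ) else 0)
        (fun a _ => by positivity) (Finset.mem_univ i))
      simp [hπ, hij]
    · exact Finset.sum_nonneg fun a _ => by positivity
  · intro i
    rw [Finset.sum_sub_distrib, Finset.sum_comm]
    simp
  · intro j
    have h1 : ∀ σ : Equiv.Perm V, ∑ i, (if σ i = j then (1 : ℝ) else 0) = 1 := by
      intro σ
      simp_rw [← Equiv.eq_symm_apply]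
      simp
    rw [Finset.sum_sub_distrib, Finset.sum_comm]
    simp_rw [h1]
    simp

/-- Add `t` to the weight of the loop at `v`. -/
def addLoop (W : V → V → ℝ) (v : V) (t : ℝ) (a b : V) : ℝ :=
  W a b + if a = v ∧ b = v then t else 0

omit [Fintype V] in
theorem addLoop_symm {W : V → V → ℝ} (hW : ∀ a b, W a b = W b a) (v : V) (t : ℝ) (a b : V) :
    addLoop W v t a b = addLoop W v t b a := by
  simp only [addLoop, hW a b, and_comm]

theorem permWeight_addLoop (W : V → V → ℝ) (v : V) (t : ℝ) (ρ : Equiv.Perm V) :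
    permWeight (addLoop W v t) ρ = permWeight W ρ + if ρ v = v then t else 0 := by
  simp only [permWeight, addLoop, Finset.sum_add_distrib]
  congr 1
  rw [Finset.sum_eq_single v] <;> simp +contextual

/-- Among the optimal permutations, changing whether `v` is fixed costs at most one odd orbit. -/
theorem exists_isOpt_fixes_iff {W : V → V → ℝ} (hW : ∀ a b, W a b = W b a) {v : V}
    {ρ τ : Equiv.Perm V} (hρ : IsOpt W ρ) (hτ : IsOpt W τ) (hne : ρ v = v ↔ τ v ≠ v) :
    ∃ ρ', IsOpt W ρ' ∧ (ρ' v = v ↔ τ v = v) ∧ (oddOrbs ρ').card ≤ (oddOrbs ρ).card + 1 := by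
  have hB : ∀ x y, (∃ π, IsOpt W π ∧ π x = y) → ∃ π, IsOpt W π ∧ π y = x := by
    rintro x y ⟨π, hπ, rfl⟩
    exact ⟨π⁻¹, hπ.inv hW, by simp⟩
  by_cases hτv : τ v = v
  · have hρv : ρ v ≠ v := fun h => hne.1 h hτv
    have hρp : ρ (ρ⁻¹ v) = v := by simp
    set p := ρ⁻¹ v with hp
    let A : V → V → Prop := fun x y => (∃ π, IsOpt W π ∧ π x = y) ∧ (x = v ↔ y = v)
    have hAs : ∀ x y, A x y → A y x := fun x y h => ⟨hB _ _ h.1, h.2.symm⟩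
    have hAτ : ∀ x, A x (τ x) := fun x => ⟨⟨τ, hτ, rfl⟩, by
      rw [← τ.injective.eq_iff (b := v), hτv]⟩
    set θ := ρ * Equiv.swap v p with hθ
    have hθv : θ v = v := by rw [hθ, mul_swap_apply_left, hρp]
    have hAθ : ∀ x, x ≠ p → A x (θ x) := by
      intro x hx
      by_cases hxv : x = v
      · have := hAτ v
        rw [hxv, hθv]
        rwa [hτv] at this
      · rw [hθ, mul_swap_apply_of_ne hxv hx]
        refine ⟨⟨ρ, hρ, rfl⟩, iff_of_false hxv fun h => hx (ρ.injective (h.trans hρp.symm))⟩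
    have hsub : ∀ D ∈ oddOrbs θ, D ≠ orb θ p → D ∈ oddOrbs ρ := by
      intro D hD hDp
      refine Finset.mem_of_mem_erase (mem_oddOrbs_of_mul_swap hD ?_ hDp)
      rintro rfl
      have := (mem_oddOrbs.1 hD).2.1
      rw [← hθ, orb_of_fixed hθv] at this
      simp at this
    have hfin : ∀ ρ' : Equiv.Perm V, (∀ x, A x (ρ' x)) → IsOpt W ρ' ∧ (ρ' v = v ↔ τ v = v) :=
      fun ρ' h => ⟨isOpt_of_arcs fun x => (h x).1, iff_of_true ((h v).2.1 rfl) hτv⟩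
    rcases Nat.even_or_odd (orb θ p).card with hev | hodd
    · obtain ⟨ρ', h1, h2⟩ := exists_split_even_oddOrbs hAs θ p hAθ hev
      refine ⟨ρ', (hfin ρ' h1).1, (hfin ρ' h1).2,
        (Finset.card_le_card (h2.trans fun D hD => hsub D hD ?_)).trans (Nat.le_succ _)⟩
      rintro rfl
      exact Nat.not_even_iff_odd.2 (mem_oddOrbs.1 hD).2.2 hev
    · obtain ⟨ρ', h1, h2⟩ := exists_completion hAs τ hAτ θ p hAθ hodd (oddOrbs ρ).card
        (Finset.card_le_card fun D hD =>
          hsub D (Finset.mem_of_mem_erase hD) (Finset.ne_of_mem_erase hD))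
      exact ⟨ρ', (hfin ρ' h1).1, (hfin ρ' h1).2, h2⟩
  · have hρv : ρ v = v := hne.2 hτv
    let A : V → V → Prop := fun x y => (∃ π, IsOpt W π ∧ π x = y) ∧ ¬ (x = v ∧ y = v)
    obtain ⟨ρ', h1, h2⟩ := exists_completion (A := A)
      (fun x y h => ⟨hB _ _ h.1, fun h' => h.2 h'.symm⟩) τ
      (fun x => ⟨⟨τ, hτ, rfl⟩, fun h => hτv (h.1 ▸ h.2)⟩) ρ v
      (fun x hx => ⟨⟨ρ, hρ, rfl⟩, fun h => hx h.1⟩) (by simp [orb_of_fixed hρv])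
      (oddOrbs ρ).card (Finset.card_erase_le)
    exact ⟨ρ', isOpt_of_arcs fun x => (h1 x).1,
      iff_of_false (fun h => (h1 v).2 ⟨rfl, h⟩) hτv, h2⟩

theorem exists_isOpt_addLoop {W : V → V → ℝ} (hW : ∀ a b, W a b = W b a) (v : V) (t : ℝ)
    {ρ : Equiv.Perm V} (hρ : IsOpt W ρ) :
    ∃ ρ', IsOpt (addLoop W v t) ρ' ∧ (oddOrbs ρ').card ≤ (oddOrbs ρ).card + 1 := by
  obtain ⟨τ, hτ⟩ := exists_isOpt (addLoop W v t)
  by_cases hρ' : IsOpt (addLoop W v t) ρ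
  · exact ⟨ρ, hρ', Nat.le_succ _⟩
  have hlt : permWeight (addLoop W v t) ρ < permWeight (addLoop W v t) τ := by
    by_contra h
    exact hρ' (hτ.of_permWeight_le (not_lt.1 h))
  have hle := hρ τ
  rw [permWeight_addLoop, permWeight_addLoop] at hlt
  have hne : ρ v = v ↔ τ v ≠ v := by
    by_cases h1 : ρ v = v <;> by_cases h2 : τ v = v <;> simp [h1, h2] at hlt ⊢ <;> linarith
  obtain ⟨s, hsρ, hsτ⟩ : ∃ s, IsOpt (addLoop W v s) ρ ∧ IsOpt (addLoop W v s) τ := by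
    by_cases hτv : τ v = v
    · have hρv : ρ v ≠ v := fun h => hne.1 h hτv
      have hopt : IsOpt (addLoop W v (permWeight W ρ - permWeight W τ)) ρ := by
        intro σ
        have h1 := hρ σ
        have h2 := hτ σ
        simp only [permWeight_addLoop, hτv, hρv, if_true, if_false] at h1 h2 ⊢
        split_ifs at h2 ⊢ <;> linarith
      refine ⟨_, hopt, hopt.of_permWeight_le ?_⟩
      simp [permWeight_addLoop, hτv, hρv]
    · have hρv : ρ v = v := hne.2 hτv
      have hopt : IsOpt (addLoop W v (permWeight W τ - permWeight W ρ)) τ := by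
        intro σ
        have h1 := hρ σ
        have h2 := hτ σ
        simp only [permWeight_addLoop, hτv, if_false] at h1 h2 ⊢
        split_ifs at h2 ⊢ <;> linarith
      refine ⟨_, hopt.of_permWeight_le ?_, hopt⟩
      simp [permWeight_addLoop, hτv, hρv]
  obtain ⟨ρ', h1, h2, h3⟩ := exists_isOpt_fixes_iff (addLoop_symm hW v s) hsρ hsτ hne
  refine ⟨ρ', hτ.of_permWeight_le ?_, h3⟩
  have h4 := h1 τ
  rw [permWeight_addLoop, permWeight_addLoop, if_congr h2 rfl rfl] at h4 ⊢
  linarith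

/-- Add `t` to the weights of all loops at vertices of `S`. -/
def addLoops (W : V → V → ℝ) (S : Finset V) (t : ℝ) (a b : V) : ℝ :=
  W a b + if a = b ∧ a ∈ S then t else 0

omit [Fintype V] in
theorem addLoops_symm {W : V → V → ℝ} (hW : ∀ a b, W a b = W b a) (S : Finset V) (t : ℝ)
    (a b : V) : addLoops W S t a b = addLoops W S t b a := by
  unfold addLoops
  rw [hW a b]
  by_cases h : a = b
  · rw [h]
  · simp [h, Ne.symm h]

omit [Fintype V] in
theorem addLoops_insert {W : V → V → ℝ} {S : Finset V} {v : V} (hv : v ∉ S) (t : ℝ) :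
    addLoops W (insert v S) t = addLoop (addLoops W S t) v t := by
  ext a b
  unfold addLoops addLoop
  by_cases h : a = b
  · subst h
    by_cases h2 : a = v
    · subst h2; simp [hv]
    · simp [h2]
  · have : ¬ (a = v ∧ b = v) := fun h' => h (h'.1.trans h'.2.symm)
    simp [h, this]

omit [Fintype V] in
theorem addLoops_neg (W : V → V → ℝ) (S : Finset V) (t : ℝ) :
    addLoops (addLoops W S t) S (-t) = W := by
  ext a b
  unfold addLoops
  split_ifs <;> ring

theorem permWeight_addLoops (W : V → V → ℝ) (S : Finset V) (t : ℝ) (ρ : Equiv.Perm V) :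
    permWeight (addLoops W S t) ρ = permWeight W ρ + (S.filter fun a => ρ a = a).card * t := by
  simp only [permWeight, addLoops, Finset.sum_add_distrib]
  rw [← Finset.sum_filter, Finset.sum_const, nsmul_eq_mul]
  congr 4
  ext a
  simp [and_comm, eq_comm]

theorem exists_isOpt_addLoops {W : V → V → ℝ} (hW : ∀ a b, W a b = W b a) (S : Finset V)
    (t : ℝ) {ρ : Equiv.Perm V} (hρ : IsOpt W ρ) :
    ∃ ρ', IsOpt (addLoops W S t) ρ' ∧ (oddOrbs ρ').card ≤ (oddOrbs ρ).card + S.card := by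
  induction S using Finset.induction_on with
  | empty => exact ⟨ρ, by simpa [IsOpt, permWeight_addLoops] using hρ, le_rfl⟩
  | insert v S hv ih =>
    obtain ⟨ρ₁, h1, h2⟩ := ih
    obtain ⟨ρ₂, h3, h4⟩ := exists_isOpt_addLoop (addLoops_symm hW S t) v t h1
    refine ⟨ρ₂, by rwa [addLoops_insert hv], ?_⟩
    rw [Finset.card_insert_of_notMem hv]
    omega

/-- Even orbits of an optimal permutation can be split into transpositions. -/
theorem exists_isOpt_orb_odd {W : V → V → ℝ} (hW : ∀ a b, W a b = W b a)
    {ρ : Equiv.Perm V} (hρ : IsOpt W ρ) :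
    ∃ ρ', IsOpt W ρ' ∧ (oddOrbs ρ').card ≤ (oddOrbs ρ).card ∧
      ∀ x, 3 ≤ (orb ρ' x).card → Odd (orb ρ' x).card := by
  induction hn : (Finset.univ.filter fun x =>
      3 ≤ (orb ρ x).card ∧ Even (orb ρ x).card).card using Nat.strong_induction_on
    generalizing ρ with
  | _ n ih =>
  by_cases hall : ∀ x, 3 ≤ (orb ρ x).card → Odd (orb ρ x).card
  · exact ⟨ρ, hρ, le_rfl, hall⟩
  push Not at hall
  obtain ⟨z, hz3, hz⟩ := hall
  rw [Nat.not_odd_iff_even] at hz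
  have hA : ∀ x y, (∃ π, IsOpt W π ∧ π x = y) → ∃ π, IsOpt W π ∧ π y = x := by
    rintro x y ⟨π, hπ, rfl⟩
    exact ⟨π⁻¹, hπ.inv hW, by simp⟩
  obtain ⟨θ, h1, h2⟩ := exists_split_even hA ρ z (fun x _ => ⟨ρ, hρ, rfl⟩) hz
  have hθ := isOpt_of_arcs h1
  have hlt : (Finset.univ.filter fun x => 3 ≤ (orb θ x).card ∧ Even (orb θ x).card).card < n := by
    rw [← hn]
    apply Finset.card_lt_card
    rw [Finset.ssubset_iff_of_subset]
    · refine ⟨z, by simp [hz3, hz], ?_⟩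
      rcases h2 z with ⟨h, -⟩ | ⟨-, h⟩
      · exact absurd (self_mem_orb ρ z) h
      · simp [h]
    · intro x
      rcases h2 x with ⟨-, h⟩ | ⟨-, h⟩ <;> simp [h]
  obtain ⟨ρ', h3, h4, h5⟩ := ih _ hlt hθ rfl
  refine ⟨ρ', h3, h4.trans (Finset.card_le_card fun D hD => ?_), h5⟩
  obtain ⟨⟨x, rfl⟩, h6, h7⟩ := mem_oddOrbs.1 hD
  rcases h2 x with ⟨-, h⟩ | ⟨-, h⟩
  · exact mem_oddOrbs.2 ⟨⟨x, h.symm⟩, h6, h7⟩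
  · omega

/-- A number exceeding the total weight of any permutation. -/
noncomputable def bigWeight (w : Sym2 V → ℝ) : ℝ := 1 + ∑ a, ∑ b, w s(a, b)

open Classical in
/-- The weight matrix of a graph: loops have weight zero, non-edges a prohibitive one. -/
noncomputable def graphWeight (G : SimpleGraph V) (w : Sym2 V → ℝ) (a b : V) : ℝ :=
  if a = b then 0 else if G.Adj a b then w s(a, b) else -bigWeight w

@[simp]
theorem graphWeight_self (G : SimpleGraph V) (w : Sym2 V → ℝ) (a : V) :
    graphWeight G w a a = 0 := by simp [graphWeight]

theorem graphWeight_of_adj {G : SimpleGraph V} (w : Sym2 V → ℝ) {a b : V} (h : G.Adj a b) :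
    graphWeight G w a b = w s(a, b) := by simp [graphWeight, h, h.ne]

theorem graphWeight_symm (G : SimpleGraph V) (w : Sym2 V → ℝ) (a b : V) :
    graphWeight G w a b = graphWeight G w b a := by
  unfold graphWeight
  rw [Sym2.eq_swap]
  refine if_congr eq_comm rfl ?_
  congr 1
  rw [G.adj_comm]

theorem permWeight_graphWeight_one (G : SimpleGraph V) (w : Sym2 V → ℝ) :
    permWeight (graphWeight G w) 1 = 0 := by simp [permWeight]

omit [DecidableEq V] in
theorem bigWeight_pos {w : Sym2 V → ℝ} (hw : ∀ e, 0 ≤ w e) : 0 < bigWeight w := by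
  have : 0 ≤ ∑ a, ∑ b, w s(a, b) :=
    Finset.sum_nonneg fun a _ => Finset.sum_nonneg fun b _ => hw _
  unfold bigWeight
  linarith

theorem graphWeight_le (G : SimpleGraph V) {w : Sym2 V → ℝ} (hw : ∀ e, 0 ≤ w e) (a b : V) :
    graphWeight G w a b ≤ w s(a, b) := by
  have := bigWeight_pos hw
  have := hw s(a, b)
  unfold graphWeight
  split_ifs <;> linarith

omit [DecidableEq V] in
theorem sum_lt_bigWeight {w : Sym2 V → ℝ} (hw : ∀ e, 0 ≤ w e) (ρ : Equiv.Perm V) :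
    ∑ a, w s(a, ρ a) < bigWeight w := by
  have : ∑ a, w s(a, ρ a) ≤ ∑ a, ∑ b, w s(a, b) := Finset.sum_le_sum fun a _ =>
    Finset.single_le_sum (f := fun b => w s(a, b)) (fun b _ => hw _) (Finset.mem_univ (ρ a))
  unfold bigWeight
  linarith

theorem IsOpt.adj {G : SimpleGraph V} {w : Sym2 V → ℝ} (hw : ∀ e, 0 ≤ w e)
    {ρ : Equiv.Perm V} (hρ : IsOpt (graphWeight G w) ρ) {x : V} (hx : ρ x ≠ x) :
    G.Adj x (ρ x) := by
  by_contra h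
  have h1 := hρ 1
  rw [permWeight_graphWeight_one, permWeight, ← Finset.add_sum_erase _ _ (Finset.mem_univ x)] at h1
  have h2 : graphWeight G w x (ρ x) = -bigWeight w := by simp [graphWeight, hx.symm, h]
  have h3 := sum_lt_bigWeight hw ρ
  rw [← Finset.add_sum_erase _ _ (Finset.mem_univ x)] at h3
  have h4 : ∑ a ∈ Finset.univ.erase x, graphWeight G w a (ρ a) ≤
      ∑ a ∈ Finset.univ.erase x, w s(a, ρ a) :=
    Finset.sum_le_sum fun a _ => graphWeight_le G hw _ _
  have h5 := hw s(x, ρ x)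
  linarith

theorem IsOpt.fixes {G : SimpleGraph V} {w : Sym2 V → ℝ} (hw : ∀ e, 0 ≤ w e) {S : Finset V}
    {ρ : Equiv.Perm V} (hρ : IsOpt (addLoops (graphWeight G w) S (bigWeight w)) ρ)
    {x : V} (hx : x ∈ S) : ρ x = x := by
  by_contra h
  have h1 := hρ 1
  rw [permWeight_addLoops, permWeight_addLoops, permWeight_graphWeight_one] at h1
  have h2 : ((S.filter fun a => ρ a = a).card : ℝ) + 1 ≤ S.card := by
    have : (S.filter fun a => ρ a = a).card < S.card :=
      Finset.card_lt_card (Finset.filter_ssubset.2 ⟨x, hx, h⟩)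
    exact_mod_cast this
  have h3 : permWeight (graphWeight G w) ρ < bigWeight w :=
    (Finset.sum_le_sum fun a _ => graphWeight_le G hw _ _).trans_lt (sum_lt_bigWeight hw ρ)
  have h4 := bigWeight_pos hw
  have h5 : (S.filter fun a => (1 : Equiv.Perm V) a = a) = S := by simp
  rw [h5] at h1
  nlinarith

theorem permWeight_deleteEdges {G : SimpleGraph V} {w : Sym2 V → ℝ} {F : Set (Sym2 V)}
    {S : Finset V} (hFS : ∀ e ∈ F, ∃ v ∈ S, v ∈ e) {ρ : Equiv.Perm V} (hρ : ∀ x ∈ S, ρ x = x) :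
    permWeight (graphWeight (G.deleteEdges F) w) ρ = permWeight (graphWeight G w) ρ := by
  refine Finset.sum_congr rfl fun a _ => ?_
  by_cases ha : ρ a = a
  · simp [ha]
  have hF : s(a, ρ a) ∉ F := by
    intro h
    obtain ⟨v, hv, hva⟩ := hFS _ h
    rcases Sym2.mem_iff.1 hva with rfl | rfl
    · exact ha (hρ _ hv)
    · exact ha (ρ.injective (hρ _ hv))
  unfold graphWeight
  refine if_congr Iff.rfl rfl ?_
  congr 1
  simp [SimpleGraph.deleteEdges_adj, hF]

theorem isOpt_of_deleteEdges {G : SimpleGraph V} {w : Sym2 V → ℝ} (hw : ∀ e, 0 ≤ w e)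
    {F : Set (Sym2 V)} {S : Finset V} (hFS : ∀ e ∈ F, ∃ v ∈ S, v ∈ e) {ρ : Equiv.Perm V}
    (hρ : IsOpt (addLoops (graphWeight (G.deleteEdges F) w) S (bigWeight w)) ρ) :
    IsOpt (addLoops (graphWeight G w) S (bigWeight w)) ρ := by
  obtain ⟨τ, hτ⟩ := exists_isOpt (addLoops (graphWeight G w) S (bigWeight w))
  refine hτ.of_permWeight_le ?_
  have h := hρ τ
  rwa [permWeight_addLoops, permWeight_addLoops, permWeight_deleteEdges hFS fun _ => hτ.fixes hw,
    permWeight_deleteEdges hFS fun _ => hρ.fixes hw, ← permWeight_addLoops,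
    ← permWeight_addLoops] at h

theorem sum_sym2_eq {f : Sym2 V → ℝ} (hf : ∀ a, f s(a, a) = 0) :
    2 * ∑ e, f e = ∑ a, ∑ b, f s(a, b) := by
  rw [← Fintype.sum_prod_type', ← Finset.sum_fiberwise Finset.univ
    (fun p : V × V => s(p.1, p.2)), Finset.mul_sum]
  refine Finset.sum_congr rfl fun e _ => ?_
  induction e with | _ a b
  rw [Finset.sum_congr rfl fun p hp => congrArg f (Finset.mem_filter.1 hp).2, Finset.sum_const,
    nsmul_eq_mul]
  by_cases h : a = b
  · rw [h, hf]; simp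
  · have : (Finset.univ.filter fun p : V × V => s(p.1, p.2) = s(a, b)) = {(a, b), (b, a)} := by
      ext ⟨c, d⟩
      simp
    rw [this, Finset.card_pair (by simp [h])]
    norm_num

theorem two_mul_fracWeight {G : SimpleGraph V} {w x : Sym2 V → ℝ} (hx : IsFracMatching G x) :
    2 * fracWeight w x = ∑ a, ∑ b, w s(a, b) * x s(a, b) :=
  sum_sym2_eq fun a => by rw [hx.2.1 _ (by simp), mul_zero]

theorem two_mul_fracWeight_le {G : SimpleGraph V} {w x : Sym2 V → ℝ} (hx : IsFracMatching G x)
    {ρ : Equiv.Perm V} (hρ : IsOpt (graphWeight G w) ρ) :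
    2 * fracWeight w x ≤ permWeight (graphWeight G w) ρ := by
  have hdiag : ∀ a, x s(a, a) = 0 := fun a => hx.2.1 _ (by simp)
  have h := sum_mul_le_of_permWeight_le (W := graphWeight G w) (s := 1)
    (X := fun a b => x s(a, b) + if a = b then 1 - ∑ u, x s(a, u) else 0)
    (M := permWeight (graphWeight G w) ρ) zero_le_one ?_ ?_ ?_ hρ
  · rw [one_mul] at h
    refine le_trans (le_of_eq ?_) h
    rw [two_mul_fracWeight hx]
    refine Finset.sum_congr rfl fun a _ => Finset.sum_congr rfl fun b _ => ?_
    by_cases hab : a = b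
    · subst hab; simp [hdiag]
    · by_cases hadj : G.Adj a b
      · simp [graphWeight_of_adj w hadj, hab]
      · simp [hx.2.1 s(a, b) (by simpa using hadj), hab]
  · intro a b
    have := hx.1 s(a, b)
    have := hx.2.2 a
    split_ifs <;> linarith
  · intro a
    rw [Finset.sum_add_distrib]
    simp
  · intro b
    rw [Finset.sum_add_distrib]
    simp [Sym2.eq_swap (b := b)]

/-- The half-integral vector which gives each arc of a permutation, loops excepted,
the value one half. -/
noncomputable def permFrac (ρ : Equiv.Perm V) : Sym2 V → ℝ :=
  Sym2.lift ⟨fun a b => if a = b then 0 else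
    ((if ρ a = b then 1 else 0) + (if ρ b = a then 1 else 0)) / 2, fun a b => by
      simp only [eq_comm (a := a) (b := b), add_comm]⟩

omit [Fintype V] in
theorem permFrac_mk (ρ : Equiv.Perm V) (a b : V) : permFrac ρ s(a, b) = if a = b then 0 else
    ((if ρ a = b then 1 else 0) + (if ρ b = a then 1 else 0)) / 2 := rfl

omit [Fintype V] in
theorem isHalfIntegral_permFrac (ρ : Equiv.Perm V) : IsHalfIntegral (permFrac ρ) := by
  intro e
  induction e with | _ a b
  rw [permFrac_mk]
  split_ifs <;> norm_num

omit [Fintype V] in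
theorem permFrac_eq_half_iff (ρ : Equiv.Perm V) (e : Sym2 V) :
    permFrac ρ e = 1 / 2 ↔ ∃ v, ρ (ρ v) ≠ v ∧ s(v, ρ v) = e := by
  induction e with | _ a b
  constructor
  · intro h
    rw [permFrac_mk] at h
    split_ifs at h with h1 h2 h3 h3
    · norm_num at h
    · norm_num at h
    · exact ⟨a, by rwa [h2], by rw [h2]⟩
    · exact ⟨b, by rwa [h3], by rw [h3, Sym2.eq_swap]⟩
    · norm_num at h
  · rintro ⟨v, hv, h⟩
    have hv' : v ≠ ρ v := fun h' => hv (by rw [← h', ← h'])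
    rw [← h, permFrac_mk]
    simp [hv, hv']

theorem isFracMatching_permFrac {G : SimpleGraph V} {ρ : Equiv.Perm V}
    (hρ : ∀ x, ρ x ≠ x → G.Adj x (ρ x)) : IsFracMatching G (permFrac ρ) := by
  have h0 : ∀ a b, permFrac ρ s(a, b) ≤
      ((if ρ a = b then 1 else 0) + (if ρ b = a then 1 else 0)) / 2 := by
    intro a b
    rw [permFrac_mk]
    split_ifs <;> norm_num
  refine ⟨fun e => ?_, fun e he => ?_, fun v => ?_⟩
  · rcases isHalfIntegral_permFrac ρ e with h | h | h <;> rw [h] <;> norm_num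
  · induction e with | _ a b
    rw [SimpleGraph.mem_edgeSet] at he
    rw [permFrac_mk]
    split_ifs with h1 h2 h3 h3
    · rfl
    · exact absurd (h2 ▸ hρ a (h2 ▸ Ne.symm h1)) he
    · exact absurd (h2 ▸ hρ a (h2 ▸ Ne.symm h1)) he
    · exact absurd (h3 ▸ hρ b (h3 ▸ h1)).symm he
    · norm_num
  · refine (Finset.sum_le_sum fun u _ => h0 v u).trans (le_of_eq ?_)
    have h1 : ∑ u, (if ρ u = v then (1 : ℝ) else 0) = 1 := by
      simp_rw [← Equiv.eq_symm_apply]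
      simp
    rw [← Finset.sum_div, Finset.sum_add_distrib, h1]
    simp

theorem two_mul_fracWeight_permFrac {G : SimpleGraph V} (w : Sym2 V → ℝ) {ρ : Equiv.Perm V}
    (hρ : ∀ x, ρ x ≠ x → G.Adj x (ρ x)) :
    2 * fracWeight w (permFrac ρ) = permWeight (graphWeight G w) ρ := by
  have h1 : ∑ a, ∑ b, graphWeight G w a b * (if ρ b = a then 1 else 0) =
      permWeight (graphWeight G w) ρ := by
    rw [Finset.sum_comm]
    rw [← sum_permMatrix]
    exact Finset.sum_congr rfl fun b _ => Finset.sum_congr rfl fun a _ => by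
      rw [graphWeight_symm]
  have h2 : permWeight (graphWeight G w) ρ = ∑ a, ∑ b, graphWeight G w a b *
      (((if ρ a = b then 1 else 0) + (if ρ b = a then 1 else 0)) / 2) := by
    simp_rw [mul_div_assoc', mul_add, ← Finset.sum_div, Finset.sum_add_distrib, h1,
      sum_permMatrix]
    ring
  rw [two_mul_fracWeight (isFracMatching_permFrac hρ), h2]
  refine Finset.sum_congr rfl fun a _ => Finset.sum_congr rfl fun b _ => ?_
  rw [permFrac_mk]
  by_cases hab : a = b
  · simp [hab]
  rw [if_neg hab]
  by_cases hadj : G.Adj a b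
  · rw [graphWeight_of_adj w hadj]
  · have h3 : ρ a ≠ b := fun h => hadj (h ▸ hρ a (h ▸ Ne.symm hab))
    have h4 : ρ b ≠ a := fun h => hadj (h ▸ hρ b (h ▸ hab)).symm
    simp [h3, h4]

theorem isMaxFracMatching_permFrac {G : SimpleGraph V} {w : Sym2 V → ℝ} (hw : ∀ e, 0 ≤ w e)
    {ρ : Equiv.Perm V} (hρ : IsOpt (graphWeight G w) ρ) :
    IsMaxFracMatching G w (permFrac ρ) := by
  have hadj := fun x => hρ.adj hw (x := x)
  refine ⟨isFracMatching_permFrac hadj, fun y hy => ?_⟩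
  have h1 := two_mul_fracWeight_le hy hρ
  rw [← two_mul_fracWeight_permFrac w hadj] at h1
  linarith

theorem two_mul_nuf {G : SimpleGraph V} {w : Sym2 V → ℝ} (hw : ∀ e, 0 ≤ w e)
    {ρ : Equiv.Perm V} (hρ : IsOpt (graphWeight G w) ρ) :
    2 * nuf G w = permWeight (graphWeight G w) ρ := by
  have h := isMaxFracMatching_permFrac hw hρ
  have : IsGreatest {r : ℝ | ∃ x : Sym2 V → ℝ, IsFracMatching G x ∧ r = fracWeight w x}
      (fracWeight w (permFrac ρ)) :=
    ⟨⟨_, h.1, rfl⟩, by rintro _ ⟨y, hy, rfl⟩; exact h.2 y hy⟩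
  rw [nuf, this.csSup_eq, two_mul_fracWeight_permFrac w fun x => hρ.adj hw]

omit [DecidableEq V] in
theorem exists_setWeight_eq_nu (G : SimpleGraph V) (w : Sym2 V → ℝ) :
    ∃ M, IsMatching G M ∧ nu G w = setWeight w M := by
  have hfin : {r : ℝ | ∃ M : Finset (Sym2 V), IsMatching G M ∧ r = setWeight w M}.Finite :=
    (Set.finite_range (setWeight w)).subset (by rintro _ ⟨M, -, rfl⟩; exact ⟨M, rfl⟩)
  exact Set.Nonempty.csSup_mem (s := {r : ℝ | ∃ M, IsMatching G M ∧ r = setWeight w M})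
    ⟨_, ∅, ⟨by simp, by simp⟩, rfl⟩ hfin

/-- The involution exchanging the ends of each edge of a matching. -/
theorem exists_involution {G : SimpleGraph V} {M : Finset (Sym2 V)} (hM : IsMatching G M)
    (w : Sym2 V → ℝ) :
    ∃ ρ : Equiv.Perm V, (∀ x, ρ (ρ x) = x) ∧
      permWeight (graphWeight G w) ρ = 2 * setWeight w M := by
  classical
  have huniq : ∀ {v a b}, s(v, a) ∈ M → s(v, b) ∈ M → a = b := by
    intro v a b ha hb
    by_contra h
    exact hM.2 _ ha _ hb (fun h' => h (Sym2.congr_right.1 h')) v (by simp) (by simp)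
  have hne : ∀ {a}, s(a, a) ∉ M := fun {a} h => by simpa using hM.1 h
  have hf : ∀ v, ∃ u, s(v, u) ∈ M ∨ (u = v ∧ ∀ u, s(v, u) ∉ M) := by
    intro v
    by_cases h : ∃ u, s(v, u) ∈ M
    · exact h.imp fun u => Or.inl
    · exact ⟨v, Or.inr ⟨rfl, not_exists.1 h⟩⟩
  choose f hf using hf
  have hinv : Function.Involutive f := by
    intro v
    rcases hf v with h | ⟨h, -⟩
    · rcases hf (f v) with h' | ⟨-, h'⟩
      · exact huniq h' (by rwa [Sym2.eq_swap])
      · exact absurd (Sym2.eq_swap ▸ h) (h' v)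
    · rw [h, h]
  refine ⟨hinv.toPerm, hinv, ?_⟩
  have h1 : setWeight w M = ∑ e, if e ∈ M then w e else 0 := by simp [setWeight]
  rw [h1, sum_sym2_eq fun a => by simp [hne]]
  refine Finset.sum_congr rfl fun a _ => ?_
  rw [Function.Involutive.coe_toPerm]
  rcases hf a with h | ⟨h, h'⟩
  · rw [Finset.sum_eq_single (f a) (fun b _ hb => if_neg fun h' => hb (huniq h' h)) (by simp),
      if_pos h, graphWeight_of_adj w (by simpa using hM.1 h)]
  · simp [h, h']

theorem IsStable.exists_isOpt {G : SimpleGraph V} {w : Sym2 V → ℝ} (hw : ∀ e, 0 ≤ w e)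
    (h : IsStable G w) : ∃ ρ, IsOpt (graphWeight G w) ρ ∧ oddOrbs ρ = ∅ := by
  obtain ⟨M, hM, hMw⟩ := exists_setWeight_eq_nu G w
  obtain ⟨ρ, hinv, hρ⟩ := exists_involution hM w
  obtain ⟨τ, hτ⟩ := Stabilizer.exists_isOpt (graphWeight G w)
  refine ⟨ρ, hτ.of_permWeight_le ?_, ?_⟩
  · rw [hρ, ← two_mul_nuf hw hτ, ← hMw, h]
  · rw [Finset.eq_empty_iff_forall_notMem]
    intro D hD
    obtain ⟨⟨x, rfl⟩, h3, -⟩ := mem_oddOrbs.1 hD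
    have := orb_card_le_two (hinv x)
    omega

omit [Fintype V] [DecidableEq V] in
theorem exists_walk_iterate {G : SimpleGraph V} {f : V → V} {x : V} {n : ℕ}
    (h : ∀ k < n, G.Adj (f^[k] x) (f^[k + 1] x)) :
    ∃ p : G.Walk x (f^[n] x), p.support = (List.range (n + 1)).map (fun k => f^[k] x) ∧
      p.edges = (List.range n).map fun k => s(f^[k] x, f^[k + 1] x) := by
  induction n with
  | zero => exact ⟨.nil, by simp, by simp⟩
  | succ n ih =>
    obtain ⟨p, h1, h2⟩ := ih fun k hk => h k (by omega)
    refine ⟨p.concat (h n (by omega)), ?_, ?_⟩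
    · rw [SimpleGraph.Walk.support_concat, h1, List.range_succ (n := n + 1)]
      simp
    · rw [SimpleGraph.Walk.edges_concat, h2, List.range_succ (n := n)]
      simp

theorem orb_eq_image (ρ : Equiv.Perm V) (x : V) :
    orb ρ x = (Finset.range (Function.minimalPeriod ρ x)).image fun k => ρ^[k] x := by
  ext y
  simp only [mem_orb, Finset.mem_image, Finset.mem_range]
  constructor
  · intro h
    obtain ⟨k, rfl⟩ := h.exists_nat_pow_eq
    have hpos : 0 < Function.minimalPeriod ρ x :=
      Function.minimalPeriod_pos_of_mem_periodicPts (ρ.injective.mem_periodicPts x)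
    refine ⟨k % Function.minimalPeriod ρ x, Nat.mod_lt _ hpos, ?_⟩
    rw [Function.iterate_mod_minimalPeriod_eq, Equiv.Perm.iterate_eq_pow]
  · rintro ⟨k, -, rfl⟩
    exact ⟨k, by simp [Equiv.Perm.iterate_eq_pow]⟩

theorem card_orb (ρ : Equiv.Perm V) (x : V) :
    (orb ρ x).card = Function.minimalPeriod ρ x := by
  rw [orb_eq_image, Finset.card_image_of_injOn, Finset.card_range]
  simpa [Set.InjOn] using Function.iterate_injOn_Iio_minimalPeriod (f := ρ) (x := x)

/-- An odd orbit along edges of a graph is an odd cycle. -/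
theorem isOddCycleEdgeSet_orb {G : SimpleGraph V} {ρ : Equiv.Perm V}
    (hρ : ∀ x, ρ x ≠ x → G.Adj x (ρ x)) {D : Finset V} (hD : D ∈ oddOrbs ρ) :
    IsOddCycleEdgeSet G (D.image fun v => s(v, ρ v)) := by
  obtain ⟨⟨x, rfl⟩, h3, hodd⟩ := mem_oddOrbs.1 hD
  rw [card_orb] at h3 hodd
  have hinj := Function.iterate_injOn_Iio_minimalPeriod (f := ρ) (x := x)
  have himg := orb_eq_image ρ x
  have hper := Function.iterate_minimalPeriod (f := ρ) (x := x)
  obtain ⟨m, hm⟩ : ∃ m, Function.minimalPeriod ρ x = m + 1 := ⟨_, (Nat.succ_pred (by omega)).symm⟩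
  rw [hm] at h3 hodd hinj himg hper
  have hinj' : ∀ i j, i < m + 1 → j < m + 1 → ρ^[i] x = ρ^[j] x → i = j :=
    fun i j hi hj h => hinj hi hj h
  have hne : ∀ k, ρ (ρ^[k] x) ≠ ρ^[k] x := by
    intro k h
    rw [← Function.iterate_succ_apply' (f := ρ), Function.iterate_succ_apply] at h
    have := (ρ.injective.iterate k) h
    exact absurd (hinj' 1 0 (by omega) (by omega) this) (by simp)
  have hadj : ∀ k, G.Adj (ρ^[k] x) (ρ^[k + 1] x) := by
    intro k
    rw [Function.iterate_succ_apply']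
    exact hρ _ (hne k)
  obtain ⟨p, hs, he⟩ := exists_walk_iterate (n := m) fun k _ => hadj k
  have hlast : G.Adj (ρ^[m] x) x := by
    have := hadj m
    rwa [hper] at this
  have hedges : (SimpleGraph.Walk.cons hlast p).edges =
      s(ρ^[m] x, x) :: (List.range m).map fun k => s(ρ^[k] x, ρ^[k + 1] x) := by
    rw [SimpleGraph.Walk.edges_cons, he]
  refine ⟨_, .cons hlast p, ?_, ?_, ?_⟩
  · rw [SimpleGraph.Walk.cons_isCycle_iff, SimpleGraph.Walk.isPath_def, hs, he]
    constructor
    · refine List.Nodup.map_on ?_ List.nodup_range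
      intro i hi j hj h
      exact hinj' i j (List.mem_range.1 hi) (List.mem_range.1 hj) h
    · rw [List.mem_map]
      rintro ⟨k, hk, h⟩
      rw [List.mem_range] at hk
      rcases Sym2.eq_iff.1 h with ⟨h1, -⟩ | ⟨h1, h2⟩
      · have := hinj' _ _ (by omega) (by omega) h1
        omega
      · have h1 := hinj' k 0 (by omega) (by omega) h1
        have h2 := hinj' _ _ (by omega) (by omega) h2
        omega
  · rw [← SimpleGraph.Walk.length_edges, hedges]
    simpa using hodd
  · rw [hedges, himg, Finset.image_image, Finset.range_add_one, Finset.image_insert]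
    ext e
    simp [← Function.iterate_succ_apply' (f := ρ), hper]

theorem isCycleFamily_permFrac {G : SimpleGraph V} {ρ : Equiv.Perm V}
    (hρ : ∀ x, ρ x ≠ x → G.Adj x (ρ x))
    (hodd : ∀ x, 3 ≤ (orb ρ x).card → Odd (orb ρ x).card) :
    IsCycleFamily G (permFrac ρ)
      ((oddOrbs ρ).image fun D => D.image fun v => s(v, ρ v)) := by
  have hverts : ∀ D ∈ oddOrbs ρ, ∀ v ∈ edgeVerts (D.image fun v => s(v, ρ v)), D = orb ρ v := by
    rintro D hD v ⟨e, he, hv⟩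
    obtain ⟨⟨x, rfl⟩, -⟩ := mem_oddOrbs.1 hD
    obtain ⟨u, hu, rfl⟩ := Finset.mem_image.1 he
    rw [orb_eq_iff]
    rcases Sym2.mem_iff.1 hv with rfl | rfl
    · exact mem_orb.1 hu
    · exact Equiv.Perm.sameCycle_apply_right.2 (mem_orb.1 hu)
  refine ⟨?_, ?_, fun e => ?_⟩
  · intro C hC
    obtain ⟨D, hD, rfl⟩ := Finset.mem_image.1 hC
    exact isOddCycleEdgeSet_orb hρ hD
  · intro C hC C' hC' hne
    obtain ⟨D, hD, rfl⟩ := Finset.mem_image.1 hC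
    obtain ⟨D', hD', rfl⟩ := Finset.mem_image.1 hC'
    rw [Set.disjoint_left]
    intro v hv hv'
    exact hne (by rw [hverts D hD v hv, hverts D' hD' v hv'])
  · rw [permFrac_eq_half_iff]
    constructor
    · rintro ⟨v, hv, rfl⟩
      have h3 := three_le_orb_card hv
      exact ⟨_, Finset.mem_image_of_mem _ (mem_oddOrbs.2 ⟨⟨v, rfl⟩, h3, hodd v h3⟩),
        Finset.mem_image_of_mem (fun v => s(v, ρ v)) (self_mem_orb ρ v)⟩
    · rintro ⟨C, hC, he⟩
      obtain ⟨D, hD, rfl⟩ := Finset.mem_image.1 hC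
      obtain ⟨v, hv, rfl⟩ := Finset.mem_image.1 he
      obtain ⟨⟨x, rfl⟩, h3, -⟩ := mem_oddOrbs.1 hD
      refine ⟨v, fun h => ?_, rfl⟩
      have := orb_card_le_two h
      rw [← orb_eq_iff.2 (mem_orb.1 hv)] at this
      omega

theorem gamma_le_card_oddOrbs {G : SimpleGraph V} {w : Sym2 V → ℝ} (hw : ∀ e, 0 ≤ w e)
    {ρ : Equiv.Perm V} (hρ : IsOpt (graphWeight G w) ρ) : gamma G w ≤ (oddOrbs ρ).card := by
  obtain ⟨ρ', h1, h2, h3⟩ := exists_isOpt_orb_odd (graphWeight_symm G w) hρ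
  refine le_trans (Nat.sInf_le ⟨permFrac ρ', _, isMaxFracMatching_permFrac hw h1,
    isHalfIntegral_permFrac ρ', isCycleFamily_permFrac (fun x => h1.adj hw) h3, rfl⟩) ?_
  exact Finset.card_image_le.trans h2

/-- every edge-stabilizer `F` of `G` satisfies |F| ≥ ⌈γ(G)/2⌉. -/
theorem edgeStabilizer_lower_bound
    {V : Type*} [Fintype V] [DecidableEq V]
    (G : SimpleGraph V) (w : Sym2 V → ℝ) (hw : ∀ e, 0 ≤ w e)
    (F : Finset (Sym2 V)) (hFE : ↑F ⊆ G.edgeSet)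
    (hF : IsStable (G.deleteEdges ↑F) w) :
    (gamma G w + 1) / 2 ≤ F.card := by
  set S : Finset V := F.image fun e => e.out.1
  have hFS : ∀ e ∈ (↑F : Set (Sym2 V)), ∃ v ∈ S, v ∈ e := fun e he =>
    ⟨e.out.1, Finset.mem_image_of_mem _ he, e.out_fst_mem⟩
  have hS : S.card ≤ F.card := Finset.card_image_le
  obtain ⟨ρ₀, h0, h0'⟩ := hF.exists_isOpt hw
  obtain ⟨ρ₁, h1, h1'⟩ := exists_isOpt_addLoops (graphWeight_symm _ w) S (bigWeight w) h0
  obtain ⟨ρ₂, h2, h2'⟩ := exists_isOpt_addLoops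
    (addLoops_symm (graphWeight_symm G w) S (bigWeight w)) S (-bigWeight w)
    (isOpt_of_deleteEdges hw hFS h1)
  rw [addLoops_neg] at h2
  rw [h0', Finset.card_empty] at h1'
  have := gamma_le_card_oddOrbs hw h2
  omega

end Stabilizer
end

section
/- There exists a weighted graph G = (V,E) with nonnegative edge weights such that γ(G) = 2 and yet G admits an edge-stabilizer consisting of a single edge; hence γ(G) is not in general a lower bound on the cardinality of an edge-stabilizer. -/
namespace Stabilizer

variable {V : Type*} [Fintype V] [DecidableEq V]

variable {G : SimpleGraph V}

/-- The indicator function of a matching is a fractional matching. -/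
theorem IsMatching.isFracMatching_indicator {M : Finset (Sym2 V)} (hM : IsMatching G M) :
    IsFracMatching G fun e => if e ∈ M then (1 : ℝ) else 0 := by
  refine ⟨fun e => by positivity, fun e he => if_neg fun h => he (hM.1 h), fun v => ?_⟩
  rw [Finset.sum_boole]
  have : (Finset.univ.filter fun u => s(v, u) ∈ M).card ≤ 1 := by
    refine Finset.card_le_one.2 fun a ha b hb => ?_
    by_contra hab
    exact hM.2 _ (Finset.mem_filter.1 ha).2 _ (Finset.mem_filter.1 hb).2
      (fun h => hab (Sym2.congr_right.1 h)) v (Sym2.mem_mk_left _ _) (Sym2.mem_mk_left _ _)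
  exact_mod_cast this

theorem fracWeight_indicator (w : Sym2 V → ℝ) (M : Finset (Sym2 V)) :
    fracWeight w (fun e => if e ∈ M then (1 : ℝ) else 0) = setWeight w M := by
  simp [fracWeight, setWeight]

theorem IsFracMatching.mono {H : SimpleGraph V} (h : H ≤ G) {x : Sym2 V → ℝ}
    (hx : IsFracMatching H x) : IsFracMatching G x :=
  ⟨hx.1, fun e he => hx.2.1 e fun h' => he (SimpleGraph.edgeSet_mono h h'), hx.2.2⟩

/-- A matching whose weight bounds the weight of every fractional matching certifies stability. -/
theorem isStable_of_isMatching {w : Sym2 V → ℝ} {M : Finset (Sym2 V)} (hM : IsMatching G M)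
    (hmax : ∀ x, IsFracMatching G x → fracWeight w x ≤ setWeight w M) : IsStable G w := by
  have hnu : IsGreatest {r : ℝ | ∃ M, IsMatching G M ∧ r = setWeight w M} (setWeight w M) := by
    refine ⟨⟨M, hM, rfl⟩, ?_⟩
    rintro _ ⟨N, hN, rfl⟩
    rw [← fracWeight_indicator w N]
    exact hmax _ hN.isFracMatching_indicator
  have hnuf : IsGreatest {r : ℝ | ∃ x, IsFracMatching G x ∧ r = fracWeight w x}
      (setWeight w M) := by
    refine ⟨⟨_, hM.isFracMatching_indicator, (fracWeight_indicator w M).symm⟩, ?_⟩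
    rintro _ ⟨x, hx, rfl⟩
    exact hmax x hx
  exact hnu.csSup_eq.trans hnuf.csSup_eq.symm

theorem IsOddCycleEdgeSet.odd_card {C : Finset (Sym2 V)} (hC : IsOddCycleEdgeSet G C) :
    Odd C.card := by
  obtain ⟨v, c, hc, hodd, rfl⟩ := hC
  rwa [List.toFinset_card_of_nodup hc.edges_nodup, SimpleGraph.Walk.length_edges]

theorem isOddCycleEdgeSet_triangle {a b c : V} (hab : G.Adj a b) (hbc : G.Adj b c)
    (hca : G.Adj c a) : IsOddCycleEdgeSet G {s(a, b), s(b, c), s(c, a)} := by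
  refine ⟨a, .cons hab (.cons hbc (.cons hca .nil)), ?_, by simp; decide, by simp⟩
  simp [SimpleGraph.Walk.cons_isCycle_iff, hab.ne, hab.ne', hbc.ne, hca.ne, hca.ne']

/-- The edge set of the first triangle of the example. -/
def triangleA : Finset (Sym2 (Fin 8)) := {s(0, 1), s(1, 2), s(2, 0)}

/-- The edge set of the second triangle of the example. -/
def triangleB : Finset (Sym2 (Fin 8)) := {s(3, 4), s(4, 5), s(5, 3)}

/-- The edges of the example: two triangles joined by the path `0 - 6 - 7 - 3`. -/
def exampleEdges : Finset (Sym2 (Fin 8)) :=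
  {s(0, 1), s(1, 2), s(2, 0), s(3, 4), s(4, 5), s(5, 3), s(6, 7), s(0, 6), s(3, 7)}

/-- Two triangles joined by the path `0 - 6 - 7 - 3`. -/
def exampleGraph : SimpleGraph (Fin 8) := .fromEdgeSet exampleEdges

/-- The outer edges of the connecting path have weight `1`, all other edges weight `2`. -/
noncomputable def exampleWeight (e : Sym2 (Fin 8)) : ℝ :=
  if e = s(0, 6) ∨ e = s(3, 7) then 1 else 2

/-- The unique maximum-weight fractional matching of the example. -/
noncomputable def exampleMatching (e : Sym2 (Fin 8)) : ℝ :=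
  if e ∈ triangleA ∪ triangleB then 1 / 2 else if e = s(6, 7) then 1 else 0

theorem mem_edgeSet_exampleGraph {e : Sym2 (Fin 8)} :
    e ∈ exampleGraph.edgeSet ↔ e ∈ exampleEdges := by
  have h : ∀ e ∈ exampleEdges, ¬ e.IsDiag := by decide
  simp only [exampleGraph, SimpleGraph.edgeSet_fromEdgeSet, Set.mem_sdiff, Finset.mem_coe]
  exact ⟨fun h => h.1, fun he => ⟨he, h e he⟩⟩

theorem exampleGraph_adj {a b : Fin 8} : exampleGraph.Adj a b ↔ s(a, b) ∈ exampleEdges := by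
  rw [← SimpleGraph.mem_edgeSet, mem_edgeSet_exampleGraph]

theorem exampleWeight_zero_six : exampleWeight s(0, 6) = 1 := if_pos (by decide)

theorem exampleWeight_three_seven : exampleWeight s(3, 7) = 1 := if_pos (by decide)

theorem fracWeight_exampleWeight {x : Sym2 (Fin 8) → ℝ} (hx : IsFracMatching exampleGraph x) :
    fracWeight exampleWeight x =
      2 * (x s(0, 1) + x s(1, 2) + x s(2, 0) + x s(3, 4) + x s(4, 5) + x s(5, 3) + x s(6, 7)) +
        x s(0, 6) + x s(3, 7) := by
  have h : fracWeight exampleWeight x = ∑ e ∈ exampleEdges, exampleWeight e * x e := by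
    refine (Finset.sum_subset (Finset.subset_univ _) fun e _ he => ?_).symm
    rw [hx.2.1 e (mt mem_edgeSet_exampleGraph.1 he), mul_zero]
  rw [h, exampleEdges]
  repeat rw [Finset.sum_insert (by decide)]
  rw [Finset.sum_singleton]
  have h : ∀ e, ¬ (e = s(0, 6) ∨ e = s(3, 7)) → exampleWeight e = 2 := fun e he => if_neg he
  rw [exampleWeight_zero_six, exampleWeight_three_seven, h s(0, 1) (by decide),
    h s(1, 2) (by decide), h s(2, 0) (by decide), h s(3, 4) (by decide), h s(4, 5) (by decide),
    h s(5, 3) (by decide), h s(6, 7) (by decide)]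
  ring

/-- The degree constraints of a fractional matching of the example. -/
theorem degree_constraints_exampleGraph {x : Sym2 (Fin 8) → ℝ}
    (hx : IsFracMatching exampleGraph x) :
    x s(0, 1) + x s(2, 0) + x s(0, 6) ≤ 1 ∧ x s(0, 1) + x s(1, 2) ≤ 1 ∧
    x s(1, 2) + x s(2, 0) ≤ 1 ∧ x s(3, 4) + x s(5, 3) + x s(3, 7) ≤ 1 ∧
    x s(3, 4) + x s(4, 5) ≤ 1 ∧ x s(4, 5) + x s(5, 3) ≤ 1 ∧
    x s(6, 7) + x s(0, 6) ≤ 1 ∧ x s(6, 7) + x s(3, 7) ≤ 1 := by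
  have key : ∀ (v : Fin 8) (S : Finset (Fin 8)), (∀ u ∉ S, s(v, u) ∉ exampleEdges) →
      ∑ u ∈ S, x s(v, u) ≤ 1 := fun v S hS => by
    rw [Finset.sum_subset (Finset.subset_univ S) fun u _ hu =>
      hx.2.1 _ (mt mem_edgeSet_exampleGraph.1 (hS u hu))]
    exact hx.2.2 v
  have h0 := key 0 {1, 2, 6} (by decide)
  have h1 := key 1 {0, 2} (by decide)
  have h2 := key 2 {1, 0} (by decide)
  have h3 := key 3 {4, 5, 7} (by decide)
  have h4 := key 4 {3, 5} (by decide)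
  have h5 := key 5 {4, 3} (by decide)
  have h6 := key 6 {7, 0} (by decide)
  have h7 := key 7 {6, 3} (by decide)
  rw [Finset.sum_insert (by decide), Finset.sum_pair (by decide)] at h0 h3
  rw [Finset.sum_pair (by decide)] at h1 h2 h4 h5 h6 h7
  rw [Sym2.eq_swap (a := (0 : Fin 8)) (b := 2)] at h0
  rw [Sym2.eq_swap (a := (1 : Fin 8)) (b := 0)] at h1
  rw [Sym2.eq_swap (a := (2 : Fin 8)) (b := 1)] at h2
  rw [Sym2.eq_swap (a := (3 : Fin 8)) (b := 5)] at h3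
  rw [Sym2.eq_swap (a := (4 : Fin 8)) (b := 3)] at h4
  rw [Sym2.eq_swap (a := (5 : Fin 8)) (b := 4)] at h5
  rw [Sym2.eq_swap (a := (6 : Fin 8)) (b := 0)] at h6
  rw [Sym2.eq_swap (a := (7 : Fin 8)) (b := 6), Sym2.eq_swap (a := (7 : Fin 8)) (b := 3)] at h7
  refine ⟨?_, ?_, ?_, ?_, ?_, ?_, ?_, ?_⟩ <;> linarith

theorem isFracMatching_exampleMatching : IsFracMatching exampleGraph exampleMatching := by
  refine ⟨fun e => by unfold exampleMatching; positivity, fun e he => ?_, fun v => ?_⟩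
  · have hsub : ∀ e, e ∈ triangleA ∪ triangleB ∨ e = s(6, 7) → e ∈ exampleEdges := by decide
    have he' := mt (hsub e) (mt mem_edgeSet_exampleGraph.2 he)
    rw [not_or] at he'
    rw [exampleMatching, if_neg he'.1, if_neg he'.2]
  · have hdeg : ∀ v : Fin 8, ∑ u, (if s(v, u) ∈ triangleA ∪ triangleB then 1
        else if s(v, u) = s(6, 7) then 2 else 0) ≤ 2 := by decide
    have hv : ((∑ u, (if s(v, u) ∈ triangleA ∪ triangleB then 1
        else if s(v, u) = s(6, 7) then 2 else 0) : ℕ) : ℝ) ≤ 2 := by exact_mod_cast hdeg v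
    have hx : ∑ u, exampleMatching s(v, u) = ((∑ u, (if s(v, u) ∈ triangleA ∪ triangleB then 1
        else if s(v, u) = s(6, 7) then 2 else 0) : ℕ) : ℝ) / 2 := by
      rw [Nat.cast_sum, Finset.sum_div]
      refine Finset.sum_congr rfl fun u _ => ?_
      unfold exampleMatching
      split_ifs <;> norm_num
    linarith

theorem fracWeight_exampleMatching : fracWeight exampleWeight exampleMatching = 8 := by
  rw [fracWeight_exampleWeight isFracMatching_exampleMatching]
  have half : ∀ e ∈ triangleA ∪ triangleB, exampleMatching e = 1 / 2 := fun e he => if_pos he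
  have h67 : exampleMatching s(6, 7) = 1 := by
    rw [exampleMatching, if_neg (by decide), if_pos rfl]
  have zero : ∀ e, e ∉ triangleA ∪ triangleB → e ≠ s(6, 7) → exampleMatching e = 0 :=
    fun e he he' => by rw [exampleMatching, if_neg he, if_neg he']
  rw [half s(0, 1) (by decide), half s(1, 2) (by decide), half s(2, 0) (by decide),
    half s(3, 4) (by decide), half s(4, 5) (by decide), half s(5, 3) (by decide), h67,
    zero s(0, 6) (by decide) (by decide), zero s(3, 7) (by decide) (by decide)]
  norm_num

theorem isMaxFracMatching_exampleMatching :
    IsMaxFracMatching exampleGraph exampleWeight exampleMatching := by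
  refine ⟨isFracMatching_exampleMatching, fun y hy => ?_⟩
  obtain ⟨h0, h1, h2, h3, h4, h5, h6, h7⟩ := degree_constraints_exampleGraph hy
  rw [fracWeight_exampleMatching, fracWeight_exampleWeight hy]
  linarith [hy.1 s(0, 6), hy.1 s(3, 7)]

/-- The half-valued edges of a maximum-weight fractional matching of the example are exactly
the edges of the two triangles. -/
theorem eq_half_iff_of_isMaxFracMatching {x : Sym2 (Fin 8) → ℝ}
    (hx : IsMaxFracMatching exampleGraph exampleWeight x) (e : Sym2 (Fin 8)) :
    x e = 1 / 2 ↔ e ∈ triangleA ∪ triangleB := by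
  have hle := hx.2 _ isFracMatching_exampleMatching
  obtain ⟨h0, h1, h2, h3, h4, h5, h6, h7⟩ := degree_constraints_exampleGraph hx.1
  rw [fracWeight_exampleMatching, fracWeight_exampleWeight hx.1] at hle
  have p := hx.1.1 s(0, 6)
  have q := hx.1.1 s(3, 7)
  constructor
  · intro he
    have hmem : e ∈ exampleEdges := by
      by_contra h
      have := hx.1.2.1 e (mt mem_edgeSet_exampleGraph.1 h)
      norm_num [this] at he
    have hcases : ∀ e ∈ exampleEdges,
        e ∈ triangleA ∪ triangleB ∨ e = s(6, 7) ∨ e = s(0, 6) ∨ e = s(3, 7) := by decide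
    rcases hcases e hmem with h | rfl | rfl | rfl
    · exact h
    all_goals linarith
  · intro he
    simp only [triangleA, triangleB, Finset.mem_union, Finset.mem_insert,
      Finset.mem_singleton] at he
    rcases he with (rfl | rfl | rfl) | (rfl | rfl | rfl) <;> linarith

theorem isCycleFamily_exampleMatching :
    IsCycleFamily exampleGraph exampleMatching {triangleA, triangleB} := by
  have hdisj : Disjoint (edgeVerts triangleA) (edgeVerts triangleB) := by
    have : ∀ v : Fin 8, ∀ e ∈ triangleA, v ∈ e → ∀ f ∈ triangleB, v ∉ f := by decide
    refine Set.disjoint_left.2 ?_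
    rintro v ⟨e, he, hv⟩ ⟨f, hf, hv'⟩
    exact this v e he hv f hf hv'
  refine ⟨?_, ?_, fun e => ?_⟩
  · simp only [Finset.mem_insert, Finset.mem_singleton]
    rintro C (rfl | rfl)
    all_goals
      exact isOddCycleEdgeSet_triangle (exampleGraph_adj.2 (by decide))
        (exampleGraph_adj.2 (by decide)) (exampleGraph_adj.2 (by decide))
  · simp only [Finset.mem_insert, Finset.mem_singleton]
    rintro C (rfl | rfl) D (rfl | rfl) h
    exacts [(h rfl).elim, hdisj, hdisj.symm, (h rfl).elim]
  · rw [eq_half_iff_of_isMaxFracMatching isMaxFracMatching_exampleMatching]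
    simp

theorem two_le_card_of_isCycleFamily {x : Sym2 (Fin 8) → ℝ} {F : Finset (Finset (Sym2 (Fin 8)))}
    (hx : IsMaxFracMatching exampleGraph exampleWeight x) (hF : IsCycleFamily exampleGraph x F) :
    2 ≤ F.card := by
  have hmem : ∀ e, e ∈ triangleA ∪ triangleB ↔ ∃ C ∈ F, e ∈ C := fun e =>
    (eq_half_iff_of_isMaxFracMatching hx e).symm.trans (hF.2.2 e)
  obtain ⟨C, hC, -⟩ := (hmem s(0, 1)).1 (by decide)
  by_contra! hlt
  have hall : ∀ D ∈ F, D = C := fun D hD => Finset.card_le_one.1 (by omega) D hD C hC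
  have hCeq : C = triangleA ∪ triangleB := by
    ext e
    rw [hmem]
    refine ⟨fun he => ⟨C, hC, he⟩, ?_⟩
    rintro ⟨D, hD, he⟩
    exact hall D hD ▸ he
  have hodd := (hF.1 C hC).odd_card
  rw [hCeq] at hodd
  exact absurd hodd (by decide)

theorem gamma_exampleGraph : gamma exampleGraph exampleWeight = 2 := by
  refine IsLeast.csInf_eq ⟨⟨exampleMatching, {triangleA, triangleB},
    isMaxFracMatching_exampleMatching, fun e => ?_, isCycleFamily_exampleMatching,
    Finset.card_pair (by decide)⟩, ?_⟩
  · unfold exampleMatching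
    split_ifs <;> simp
  · rintro _ ⟨x, F, hx, -, hF, rfl⟩
    exact two_le_card_of_isCycleFamily hx hF

theorem isStable_exampleGraph_deleteEdges :
    IsStable (exampleGraph.deleteEdges {s(6, 7)}) exampleWeight := by
  refine isStable_of_isMatching (M := {s(0, 6), s(1, 2), s(3, 7), s(4, 5)}) ⟨?_, by decide⟩
    fun x hx => ?_
  · have hM : ∀ e ∈ ({s(0, 6), s(1, 2), s(3, 7), s(4, 5)} : Finset (Sym2 (Fin 8))),
        e ∈ exampleEdges ∧ e ≠ s(6, 7) := by decide
    intro e he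
    rw [SimpleGraph.edgeSet_deleteEdges]
    exact ⟨mem_edgeSet_exampleGraph.2 (hM e he).1, (hM e he).2⟩
  · have hx' := hx.mono (SimpleGraph.deleteEdges_le _)
    have h67 : x s(6, 7) = 0 := hx.2.1 _ (by simp)
    obtain ⟨h0, h1, h2, h3, h4, h5, -, -⟩ := degree_constraints_exampleGraph hx'
    have hM : setWeight exampleWeight {s(0, 6), s(1, 2), s(3, 7), s(4, 5)} = 6 := by
      have h12 : exampleWeight s(1, 2) = 2 := if_neg (by decide)
      have h45 : exampleWeight s(4, 5) = 2 := if_neg (by decide)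
      rw [setWeight, Finset.sum_insert (by decide), Finset.sum_insert (by decide),
        Finset.sum_pair (by decide), exampleWeight_zero_six, exampleWeight_three_seven, h12, h45]
      norm_num
    rw [hM, fracWeight_exampleWeight hx', h67]
    linarith

/-- there is a weighted graph with γ(G) = 2 admitting an
edge-stabilizer consisting of a single edge; hence γ(G) is not in general a lower
bound on the cardinality of an edge-stabilizer. -/
theorem gamma_not_edge_lower_bound :
    ∃ (n : ℕ) (G : SimpleGraph (Fin n)) (w : Sym2 (Fin n) → ℝ),
      (∀ e, 0 ≤ w e) ∧ gamma G w = 2 ∧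
      ∃ e ∈ G.edgeSet, IsStable (G.deleteEdges {e}) w := by
  exact ⟨8, exampleGraph, exampleWeight, fun e => by unfold exampleWeight; positivity,
    gamma_exampleGraph, s(6, 7), mem_edgeSet_exampleGraph.2 (by decide),
    isStable_exampleGraph_deleteEdges⟩

end Stabilizer
end

section
/- Let M be a matching in a graph G and let P be an M-alternating walk. Then P can be decomposed into consecutive segments P = P_1 P_2 ⋯ P_ℓ such that (i) each P_i is an M-alternating path, an M-alternating cycle, or an M-blossom, and (ii) there is no index i for which P_i and P_{i+1} are both M-alternating paths or both M-blossoms. -/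
namespace Stabilizer

variable {V : Type*} [Fintype V] [DecidableEq V]

variable {G : SimpleGraph V}

/-- The three possible kinds of segments in the decomposition of an alternating walk. -/
inductive SegKind where
  | path : SegKind
  | cyc : SegKind
  | blossom : SegKind

/-- `segOK M k q`: the (nonempty) walk `q` qualifies as a segment of kind `k`:
an M-alternating path, an M-alternating cycle, or an M-blossom. -/
def segOK {V : Type*} [Fintype V] [DecidableEq V] {G : SimpleGraph V}
    (M : Finset (Sym2 V)) (k : SegKind) {a b : V} (q : G.Walk a b) : Prop :=
  match k with
  | SegKind.path => ¬ q.Nil ∧ q.IsPath ∧ AltList M q.edges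
  | SegKind.cyc => ∃ h : b = a, IsAltCycle M (q.copy rfl h)
  | SegKind.blossom => ∃ h : b = a, IsBlossom M (q.copy rfl h)

/-- Two consecutive segments may not both be paths, nor both be blossoms. -/
def kindsOK : SegKind → SegKind → Prop
  | SegKind.path, SegKind.path => False
  | SegKind.blossom, SegKind.blossom => False
  | _, _ => True

/-- `Decomp G M k p`: the walk `p` decomposes into consecutive segments, each an
M-alternating path, an M-alternating cycle or an M-blossom, no two consecutive
segments both being paths or both being blossoms; `k` is the kind of the first
segment. -/
inductive Decomp {V : Type*} [Fintype V] [DecidableEq V] (G : SimpleGraph V)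
    (M : Finset (Sym2 V)) : ∀ {a b : V}, SegKind → G.Walk a b → Prop where
  | single {a b : V} (k : SegKind) (q : G.Walk a b) (hq : segOK M k q) :
      Decomp G M k q
  | cons {a m b : V} (k k' : SegKind) (q : G.Walk a m) (r : G.Walk m b)
      (hq : segOK M k q) (hr : Decomp G M k' r) (hkk' : kindsOK k k') :
      Decomp G M k (q.append r)

theorem AltList.head_mem_iff_getLast_mem {V : Type*} {M : Finset (Sym2 V)} {l : List (Sym2 V)}
    (hl : AltList M l) {e f : Sym2 V} (he : l.head? = some e) (hf : l.getLast? = some f) :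
    (e ∈ M ↔ f ∈ M) ↔ Odd l.length := by
  induction l generalizing e with
  | nil => simp at he
  | cons x t ih =>
    cases t with
    | nil => simp_all
    | cons y s =>
      obtain ⟨hxy, ht⟩ := List.isChain_cons_cons.mp hl
      have key := ih ht rfl (by simpa using hf)
      obtain rfl : x = e := by simpa using he
      rw [List.length_cons, Nat.odd_add_one, ← key]
      tauto

theorem AltList.of_append {V : Type*} {M : Finset (Sym2 V)} {l l' : List (Sym2 V)}
    (h : AltList M (l ++ l')) : AltList M l ∧ AltList M l' :=
  ⟨(List.isChain_append.mp h).1, (List.isChain_append.mp h).2.1⟩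

theorem AltList.mem_iff_of_append {V : Type*} {M : Finset (Sym2 V)} {l l' : List (Sym2 V)}
    (h : AltList M (l ++ l')) {e f : Sym2 V} (he : l.getLast? = some e)
    (hf : l'.head? = some f) : e ∈ M ↔ f ∉ M :=
  (List.isChain_append.mp h).2.2 e (by simp [he]) f (by simp [hf])

/-- An edge of a path joining its two ends can only be its first edge. -/
theorem edges_head?_of_mem_of_isPath {V : Type*} {G : SimpleGraph V} {a m : V} {c : G.Walk m a}
    (hc : c.IsPath) (h : s(a, m) ∈ c.edges) : c.edges.head? = some s(a, m) := by
  cases c with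
  | nil => simp at h
  | cons hadj t =>
    rw [SimpleGraph.Walk.cons_isPath_iff] at hc
    rw [SimpleGraph.Walk.edges_cons, List.mem_cons] at h
    rcases h with h | h
    · simp [h]
    · exact absurd (t.snd_mem_support_of_mem_edges h) hc.2

/-- Closing up an alternating path by an edge gives an alternating cycle or a blossom. -/
theorem closed_segOK {V : Type*} [Fintype V] [DecidableEq V] {G : SimpleGraph V}
    {M : Finset (Sym2 V)} (hM : IsMatching G M) {a m : V} (h : G.Adj a m) {c : G.Walk m a}
    (hc : c.IsPath) (halt : AltList M (SimpleGraph.Walk.cons h c).edges) :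
    segOK M SegKind.cyc (SimpleGraph.Walk.cons h c) ∨
      segOK M SegKind.blossom (SimpleGraph.Walk.cons h c) := by
  have hnot : s(a, m) ∉ c.edges := fun hmem => by
    have := AltList.mem_iff_of_append (l := [s(a, m)]) (l' := c.edges) halt rfl
      (edges_head?_of_mem_of_isPath hc hmem)
    tauto
  have hcyc : (SimpleGraph.Walk.cons h c).IsCycle :=
    (SimpleGraph.Walk.cons_isCycle_iff c h).mpr ⟨hc, hnot⟩
  rcases Nat.even_or_odd (SimpleGraph.Walk.cons h c).length with hev | hodd
  · refine Or.inl ⟨rfl, hcyc, hev, halt, fun e f he hf => ?_⟩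
    have key := halt.head_mem_iff_getLast_mem he hf
    rw [SimpleGraph.Walk.length_edges, ← Nat.not_even_iff_odd] at key
    have : ¬ (e ∈ M ↔ f ∈ M) := fun hh => key.mp hh hev
    tauto
  · refine Or.inr ⟨rfl, hcyc, hodd, halt, fun e he heM => ?_⟩
    obtain rfl : s(a, m) = e := by simpa using he
    have hne : ¬ c.Nil := fun hn => h.ne hn.eq.symm
    have hlast : (SimpleGraph.Walk.cons h c).edges.getLast? = some s(c.penultimate, a) := by
      have hce : c.edges ≠ [] := by simpa using hne
      rw [SimpleGraph.Walk.edges_cons, List.getLast?_cons,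
        List.getLast?_eq_some_getLast hce, c.getLast_edges_eq_mk_penultimate_end hce]
      rfl
    have hpen : s(c.penultimate, a) ∈ c.edges := c.mk_penultimate_end_mem_edges hne
    have hfM : s(c.penultimate, a) ∈ M := by
      refine ((halt.head_mem_iff_getLast_mem rfl hlast).mpr ?_).mp heM
      rwa [SimpleGraph.Walk.length_edges]
    exact hM.2 _ heM _ hfM (fun heq => hnot (heq ▸ hpen)) a (by simp) (by simp)

theorem IsBlossom.exists_head {V : Type*} [Fintype V] [DecidableEq V] {G : SimpleGraph V}
    {M : Finset (Sym2 V)} {a : V} {c : G.Walk a a} (hc : IsBlossom M c) :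
    ∃ e ∉ M, c.edges.head? = some e := by
  have hne : c.edges ≠ [] := by simpa using hc.1.not_nil
  exact ⟨c.edges.head hne, hc.2.2.2 _ (List.head?_eq_some_head hne), List.head?_eq_some_head hne⟩

theorem IsBlossom.exists_getLast {V : Type*} [Fintype V] [DecidableEq V] {G : SimpleGraph V}
    {M : Finset (Sym2 V)} {a : V} {c : G.Walk a a} (hc : IsBlossom M c) :
    ∃ e ∉ M, c.edges.getLast? = some e := by
  obtain ⟨f, hf, hhead⟩ := hc.exists_head
  have hne : c.edges ≠ [] := by simpa using hc.1.not_nil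
  refine ⟨c.edges.getLast hne, fun hl => hf ?_, List.getLast?_eq_some_getLast hne⟩
  refine ((hc.2.2.1.head_mem_iff_getLast_mem hhead
    (List.getLast?_eq_some_getLast hne)).mpr ?_).mpr hl
  simpa using hc.2.1

theorem Decomp.exists_head_of_blossom {V : Type*} [Fintype V] [DecidableEq V]
    {G : SimpleGraph V} {M : Finset (Sym2 V)} {a b : V} {p : G.Walk a b}
    (h : Decomp G M SegKind.blossom p) : ∃ e ∉ M, p.edges.head? = some e := by
  cases h with
  | single _ _ hq =>
    obtain ⟨rfl, hb⟩ := hq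
    exact hb.exists_head
  | cons _ _ q r hq _ _ =>
    obtain ⟨rfl, hb⟩ := hq
    obtain ⟨e, he, hhead⟩ := hb.exists_head
    rw [SimpleGraph.Walk.copy_rfl_rfl] at hhead
    exact ⟨e, he, by simp [SimpleGraph.Walk.edges_append, hhead]⟩

/-- A closed segment can be put in front of any decomposition of an alternating walk. -/
theorem Decomp.closed_append {V : Type*} [Fintype V] [DecidableEq V] {G : SimpleGraph V}
    {M : Finset (Sym2 V)} {a m b : V} {q : G.Walk a m} {r : G.Walk m b}
    (hq : segOK M SegKind.cyc q ∨ segOK M SegKind.blossom q)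
    (halt : AltList M (q.append r).edges) (hr : r.Nil ∨ ∃ k, Decomp G M k r) :
    ∃ k, k ≠ SegKind.path ∧ Decomp G M k (q.append r) := by
  rcases hr with hr | ⟨k', hr⟩
  · cases hr
    rw [SimpleGraph.Walk.append_nil]
    rcases hq with hq | hq
    · exact ⟨_, by simp, .single _ _ hq⟩
    · exact ⟨_, by simp, .single _ _ hq⟩
  · rcases hq with hq | hq
    · exact ⟨_, by simp, .cons _ k' _ _ hq hr (by simp [kindsOK])⟩
    · refine ⟨_, by simp, .cons _ k' _ _ hq hr ?_⟩
      cases k' with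
      | path => simp [kindsOK]
      | cyc => simp [kindsOK]
      | blossom =>
        obtain ⟨rfl, hb⟩ := hq
        obtain ⟨e, he, hlast⟩ := hb.exists_getLast
        obtain ⟨f, hf, hhead⟩ := hr.exists_head_of_blossom
        rw [SimpleGraph.Walk.edges_append] at halt
        exact absurd ((halt.mem_iff_of_append hlast hhead).mpr hf) he

/-- A path can be put in front of any decomposition that does not begin with a path. -/
theorem Decomp.path_append {V : Type*} [Fintype V] [DecidableEq V] {G : SimpleGraph V}
    {M : Finset (Sym2 V)} {a m b : V} {q : G.Walk a m} {r : G.Walk m b} (hq : q.IsPath)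
    (halt : AltList M q.edges)
    (hr : r.Nil ∨ ∃ k, k ≠ SegKind.path ∧ Decomp G M k r) :
    (q.append r).Nil ∨ ∃ k, Decomp G M k (q.append r) := by
  by_cases hn : q.Nil
  · cases hn
    exact hr.imp id fun ⟨k, _, h⟩ => ⟨k, h⟩
  · right
    rcases hr with hr | ⟨k, hk, hr⟩
    · cases hr
      rw [SimpleGraph.Walk.append_nil]
      exact ⟨SegKind.path, .single _ _ ⟨hn, hq, halt⟩⟩
    · refine ⟨SegKind.path, .cons _ k _ _ ⟨hn, hq, halt⟩ hr ?_⟩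
      cases k <;> simp_all [kindsOK]

/-- An alternating walk is a path followed by a (possibly empty) decomposed walk whose first
segment is closed. -/
theorem exists_path_append_decomp {V : Type*} [Fintype V] [DecidableEq V] {G : SimpleGraph V}
    {M : Finset (Sym2 V)} (hM : IsMatching G M) {a b : V} (p : G.Walk a b)
    (halt : AltList M p.edges) :
    ∃ (m : V) (q : G.Walk a m) (r : G.Walk m b), p = q.append r ∧ q.IsPath ∧
      (r.Nil ∨ ∃ k, k ≠ SegKind.path ∧ Decomp G M k r) := by
  induction p with
  | nil => exact ⟨_, .nil, .nil, rfl, .nil, Or.inl .nil⟩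
  | @cons a v b h p ih =>
    obtain ⟨m, q, r, rfl, hq, hr⟩ := ih (AltList.of_append (l := [s(a, v)]) halt).2
    by_cases ha : a ∈ q.support
    · have hsplit : SimpleGraph.Walk.cons h (q.append r) =
          (SimpleGraph.Walk.cons h (q.takeUntil a ha)).append ((q.dropUntil a ha).append r) := by
        rw [SimpleGraph.Walk.cons_append, SimpleGraph.Walk.append_assoc,
          SimpleGraph.Walk.take_spec]
      rw [hsplit] at halt ⊢
      have halt' := halt
      rw [SimpleGraph.Walk.edges_append, SimpleGraph.Walk.edges_append] at halt'
      refine ⟨a, .nil, _, rfl, .nil, Or.inr (Decomp.closed_append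
        (closed_segOK hM h (hq.takeUntil ha) halt'.of_append.1) halt
        (Decomp.path_append (hq.dropUntil ha) halt'.of_append.2.of_append.1 hr))⟩
    · exact ⟨m, .cons h q, r, rfl, hq.cons ha, hr⟩

/-- every (nonempty) M-alternating walk decomposes into consecutive
segments, each an M-alternating path, an M-alternating cycle or an M-blossom, such
that no two consecutive segments are both paths or both blossoms. -/
theorem altWalk_decomposition
    {V : Type*} [Fintype V] [DecidableEq V] (G : SimpleGraph V)
    (M : Finset (Sym2 V)) (hM : IsMatching G M)
    {a b : V} (p : G.Walk a b) (halt : AltList M p.edges) (hnil : ¬ p.Nil) :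
    ∃ k : SegKind, Decomp G M k p := by
  obtain ⟨m, q, r, rfl, hq, hr⟩ := exists_path_append_decomp hM p halt
  rw [SimpleGraph.Walk.edges_append] at halt
  exact (Decomp.path_append hq halt.of_append.1 hr).resolve_left hnil

end Stabilizer
end
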